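/- There exist a natural number k and a computable sequence n ↦ Σ̄_n of finite sets of words in the free group on k generators (words encoded as lists of pairs (generator, exponent sign)), with the cardinality of Σ̄_n a constant strictly greater than k, such that: (1) for every n, the group Λ_n presented by ⟨x₁,…,x_k ∣ Σ̄_n⟩ has no nontrivial finite quotients; (2) for every n, if Λ_n is nontrivial then H₂(Λ_n;ℤ) ≠ 0; and (3) there is no computable function f : ℕ → Bool such that f(n) = true if and only if Λ_n is trivial. -/

import Mathlib

/-- A group `Q` has no nontrivial finite quotients: every homomorphism from `Q`
to a finite group is trivial. -/
def NoNontrivialFiniteQuotients (Q : Type*) [Group Q] : Prop :=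
  ∀ (H : Type) [Group H] [Finite H] (f : Q →* H) (q : Q), f q = 1

/-- The map of profinite completions induced by the inclusion of the subgroup `P` of `Γ`
is surjective: every homomorphism from `Γ` onto a finite group remains surjective when
restricted to `P`. -/
def ProfiniteSurj {Γ : Type*} [Group Γ] (P : Subgroup Γ) : Prop :=
  ∀ (H : Type) [Group H] [Finite H] (f : Γ →* H),
    Function.Surjective f → Function.Surjective (f.comp P.subtype)

/-- The map of profinite completions induced by the inclusion of the subgroup `P` of `Γ`
is injective: for every finite-index normal subgroup `M` of `P` there is a finite-index
normal subgroup `L` of `Γ` with `L ∩ P ≤ M`. -/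
def ProfiniteInj {Γ : Type*} [Group Γ] (P : Subgroup Γ) : Prop :=
  ∀ M : Subgroup ↥P, M.Normal → M.FiniteIndex →
    ∃ L : Subgroup Γ, L.Normal ∧ L.FiniteIndex ∧ L.subgroupOf P ≤ M

/-- The second group homology `H₂(Q;ℤ)` with trivial ℤ-coefficients, realized via Hopf's
formula `H₂(Q;ℤ) ≅ (R ∩ [F,F])/[F,R]` for the free presentation `1 → R → F → Q → 1`
with `F` the free group on the underlying set of `Q`. -/
def H2 (Q : Type*) [Group Q] : Type _ :=
  ↥((FreeGroup.lift (id : Q → Q)).ker ⊓ commutator (FreeGroup Q)) ⧸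
    ((⁅(⊤ : Subgroup (FreeGroup Q)), (FreeGroup.lift (id : Q → Q)).ker⁆).subgroupOf
      ((FreeGroup.lift (id : Q → Q)).ker ⊓ commutator (FreeGroup Q)))

/-- A group is finitely presented if it admits a presentation with finitely many
generators and finitely many relators. -/
def FinitelyPresentedGroup (Q : Type*) [Group Q] : Prop :=
  ∃ (k : ℕ) (R : Finset (FreeGroup (Fin k))),
    Nonempty (PresentedGroup (↑R : Set (FreeGroup (Fin k))) ≃* Q)

/-- A group `G` is residually finite if every nontrivial element is detected by a
homomorphism to a finite group. -/
def ResiduallyFinite (G : Type*) [Group G] : Prop :=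
  ∀ g : G, g ≠ 1 → ∃ (H : Type) (_ : Group H) (_ : Finite H) (f : G →* H), f g ≠ 1

/-- The fibre product `P = {(g,g') : p g = p g'}` of a homomorphism `p : G →* Q`,
as a subgroup of `G × G`. -/
def fiberProduct {G Q : Type*} [Group G] [Group Q] (p : G →* Q) : Subgroup (G × G) where
  carrier := {x | p x.1 = p x.2}
  one_mem' := rfl
  mul_mem' := by
    intro a b ha hb
    simp only [Set.mem_setOf_eq, Prod.fst_mul, Prod.snd_mul, map_mul] at *
    rw [ha, hb]
  inv_mem' := by
    intro a ha
    simp only [Set.mem_setOf_eq, Prod.fst_inv, Prod.snd_inv, map_inv] at *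
    rw [ha]

/-- The group presented by generators `x₁,…,x_k` and the relators given by the words in
the list `L` (words are encoded as lists of pairs (generator, exponent sign)). -/
abbrev wordPresentedGroup (k : ℕ) (L : List (List (Fin k × Bool))) :=
  PresentedGroup (FreeGroup.mk '' {w | w ∈ L})

/-- One of the partial affine maps `a j + m j * h ↦ b j + m' j * h` takes `w` to `w'`. -/
def AffineStep {J D : Type*} (a b m m' : J → D → ℤ) (w w' : D → ℤ) : Prop :=
  ∃ j h, w = a j + m j * h ∧ w' = b j + m' j * h

namespace StackMachine

open Turing Turing.PartrecToTM2 Turing.TM2.Stmt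

/-- A nonzero base-five digit for each stack symbol. -/
def digit : Γ' → ℤ
  | .consₗ => 1
  | .cons => 2
  | .bit0 => 3
  | .bit1 => 4

lemma digit_pos (g : Γ') : 0 < digit g := by cases g <;> simp [digit]

lemma digit_lt (g : Γ') : digit g < 5 := by cases g <;> simp [digit]

lemma digit_injective : Function.Injective digit := by
  intro g g'; cases g <;> cases g' <;> simp [digit]

/-- The integer whose base-five digits are the symbols of a stack, the top one last. -/
def stackCode : List Γ' → ℤ
  | [] => 0
  | g :: l => digit g + 5 * stackCode l

/-- A statement about to be executed, together with the local store. -/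
abbrev State := Stmt' × Option (Γ' : Type)

/-- A machine state together with the contents of the stacks. -/
abbrev Config := State × (K' → List (Γ' : Type))

/-- Execution of the first instruction of a statement; halted configurations are fixed. -/
def next : Config → Config
  | ((push k f q, s), S) => ((q, s), Function.update S k (f s :: S k))
  | ((peek k f q, s), S) => ((q, f s (S k).head?), S)
  | ((pop k f q, s), S) => ((q, f s (S k).head?), Function.update S k (S k).tail)
  | ((load f q, s), S) => ((q, f s), S)
  | ((branch f q₁ q₂, s), S) => ((cond (f s) q₁ q₂, s), S)
  | ((goto f, s), S) => ((tr (f s), s), S)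
  | ((TM2.Stmt.halt, s), S) => ((TM2.Stmt.halt, s), S)

/-- The effect of an instruction on stack codes, given the symbol on top of the stack: the next
state, the stack concerned, and pairs `(r, μ)`, `(r', μ')` such that the code `r + μ * h` of this
stack is replaced by `r' + μ' * h`. -/
def effect : State → Option Γ' → State × K' × (ℤ × ℤ) × (ℤ × ℤ)
  | (push k f q, s), _ => ((q, s), k, (0, 1), (digit (f s), 5))
  | (peek k f q, s), none => ((q, f s none), k, (0, 0), (0, 0))
  | (peek k f q, s), some g => ((q, f s (some g)), k, (digit g, 5), (digit g, 5))
  | (pop k f q, s), none => ((q, f s none), k, (0, 0), (0, 0))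
  | (pop k f q, s), some g => ((q, f s (some g)), k, (digit g, 5), (0, 1))
  | (load f q, s), _ => ((q, f s), .main, (0, 1), (0, 1))
  | (branch f q₁ q₂, s), _ => ((cond (f s) q₁ q₂, s), .main, (0, 1), (0, 1))
  | (goto f, s), _ => ((tr (f s), s), .main, (0, 1), (0, 1))
  | (TM2.Stmt.halt, s), _ => ((TM2.Stmt.halt, s), .main, (0, 1), (0, 1))

/-- The integer vector with a given state coordinate and given stack coordinates. -/
def vec (z : ℤ) (f : K' → ℤ) : Option K' → ℤ
  | none => z
  | some k => f k

variable (ι : State → ℤ)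

/-- The encoding of configurations as integer vectors. -/
def encodeConfig (c : Config) : Option K' → ℤ :=
  vec (ι c.1) fun k => stackCode (c.2 k)

/-- The instruction of a state acting on integer vectors. -/
def MachineStep (st : State) (o : Option Γ') (w w' : Option K' → ℤ) : Prop :=
  w none = ι st ∧ w' none = ι (effect st o).1 ∧
    (∃ h, w (some (effect st o).2.1) = (effect st o).2.2.1.1 + (effect st o).2.2.1.2 * h ∧
      w' (some (effect st o).2.1) = (effect st o).2.2.2.1 + (effect st o).2.2.2.2 * h) ∧
    ∀ k, k ≠ (effect st o).2.1 → w' (some k) = w (some k)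

lemma machineStep_next (c : Config) :
    ∃ o, MachineStep ι c.1 o (encodeConfig ι c) (encodeConfig ι (next c)) := by
  obtain ⟨⟨q, s⟩, S⟩ := c
  rcases q with ⟨k, f, q⟩ | ⟨k, f, q⟩ | ⟨k, f, q⟩ | ⟨f, q⟩ | ⟨f, q₁, q₂⟩ | f | _
  · refine ⟨none, rfl, rfl, ⟨stackCode (S k), ?_, ?_⟩, ?_⟩ <;>
      simp +contextual [effect, next, encodeConfig, vec, stackCode]
  · refine ⟨(S k).head?, ?_⟩
    rcases h : S k with _ | ⟨g, l⟩
    · refine ⟨rfl, ?_, ⟨0, ?_, ?_⟩, ?_⟩ <;>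
        simp +contextual [effect, next, encodeConfig, vec, stackCode, h]
    · refine ⟨rfl, ?_, ⟨stackCode l, ?_, ?_⟩, ?_⟩ <;>
        simp +contextual [effect, next, encodeConfig, vec, stackCode, h]
  · refine ⟨(S k).head?, ?_⟩
    rcases h : S k with _ | ⟨g, l⟩
    · refine ⟨rfl, ?_, ⟨0, ?_, ?_⟩, ?_⟩ <;>
        simp +contextual [effect, next, encodeConfig, vec, stackCode, h]
    · refine ⟨rfl, ?_, ⟨stackCode l, ?_, ?_⟩, ?_⟩ <;>
        simp +contextual [effect, next, encodeConfig, vec, stackCode, h]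
  all_goals
    refine ⟨none, rfl, rfl, ⟨stackCode (S .main), ?_, ?_⟩, ?_⟩ <;>
      simp +contextual [effect, next, encodeConfig, vec]

lemma machineStep_unique {st : State} {o o' : Option Γ'} {w w₁ w₂ : Option K' → ℤ}
    (h₁ : MachineStep ι st o w w₁) (h₂ : MachineStep ι st o' w w₂) : w₁ = w₂ := by
  have key : (effect st o).2.1 = (effect st o').2.1 ∧ w₁ none = w₂ none ∧
      w₁ (some (effect st o).2.1) = w₂ (some (effect st o).2.1) := by
    obtain ⟨-, h₁n, ⟨h, h₁k, h₁k'⟩, -⟩ := h₁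
    obtain ⟨-, h₂n, ⟨h', h₂k, h₂k'⟩, -⟩ := h₂
    rw [h₁n, h₂n]
    obtain ⟨q, s⟩ := st
    rcases q with ⟨k, f, q⟩ | ⟨k, f, q⟩ | ⟨k, f, q⟩ | ⟨f, q⟩ | ⟨f, q₁, q₂⟩ | f | _
    case peek | pop =>
      rcases o with _ | g <;> rcases o' with _ | g' <;>
        simp only [effect] at h₁k h₁k' h₂k h₂k'
      · exact ⟨rfl, rfl, by simp only [effect]; omega⟩
      · have := digit_pos g'; have := digit_lt g'; omega
      · have := digit_pos g; have := digit_lt g; omega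
      · have := digit_pos g; have := digit_lt g
        have := digit_pos g'; have := digit_lt g'
        obtain rfl : g = g' := digit_injective (by omega)
        exact ⟨rfl, rfl, by simp only [effect]; omega⟩
    all_goals
      simp only [effect] at h₁k h₁k' h₂k h₂k'
      exact ⟨rfl, rfl, by simp only [effect]; omega⟩
  funext d
  rcases d with _ | k
  · exact key.2.1
  · by_cases hk : k = (effect st o).2.1
    · rw [hk]; exact key.2.2
    · rw [h₁.2.2.2 k hk, h₂.2.2.2 k (key.1 ▸ hk)]

/-- The constant part of the source of the affine move attached to a state and a top symbol. -/
def src (st : State) (o : Option Γ') : Option K' → ℤ :=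
  vec (ι st) (Function.update 0 (effect st o).2.1 (effect st o).2.2.1.1)

/-- The constant part of the target of the affine move attached to a state and a top symbol. -/
def tgt (st : State) (o : Option Γ') : Option K' → ℤ :=
  vec (ι (effect st o).1) (Function.update 0 (effect st o).2.1 (effect st o).2.2.2.1)

/-- The multiplier in the source of the affine move attached to a state and a top symbol. -/
def srcMul (st : State) (o : Option Γ') : Option K' → ℤ :=
  vec 0 (Function.update 1 (effect st o).2.1 (effect st o).2.2.1.2)

/-- The multiplier in the target of the affine move attached to a state and a top symbol. -/
def tgtMul (st : State) (o : Option Γ') : Option K' → ℤ :=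
  vec 0 (Function.update 1 (effect st o).2.1 (effect st o).2.2.2.2)

lemma machineStep_iff {st : State} {o : Option Γ'} {w w' : Option K' → ℤ} :
    MachineStep ι st o w w' ↔
      ∃ h, w = src ι st o + srcMul st o * h ∧ w' = tgt ι st o + tgtMul st o * h := by
  constructor
  · rintro ⟨hn, hn', ⟨h, hk, hk'⟩, hne⟩
    refine ⟨fun d => d.elim 0 fun k => if k = (effect st o).2.1 then h else w (some k), ?_, ?_⟩ <;>
    · funext d
      rcases d with _ | k
      · simp [src, srcMul, tgt, tgtMul, vec, hn, hn']
      · by_cases hd : k = (effect st o).2.1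
        · subst hd; simp [src, srcMul, tgt, tgtMul, vec, hk, hk']
        · simp [src, srcMul, tgt, tgtMul, vec, hd, hne]
  · rintro ⟨h, rfl, rfl⟩
    refine ⟨?_, ?_, ⟨h (some (effect st o).2.1), ?_, ?_⟩, fun k hk => ?_⟩ <;>
      simp [src, srcMul, tgt, tgtMul, vec, *]

lemma srcMul_eq_zero_iff (st : State) (o : Option Γ') (d : Option K') :
    srcMul st o d = 0 ↔ tgtMul st o d = 0 := by
  rcases d with _ | k
  · simp [srcMul, tgtMul, vec]
  · by_cases hk : k = (effect st o).2.1
    · subst hk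
      obtain ⟨q, s⟩ := st
      rcases q with ⟨k, f, q⟩ | ⟨k, f, q⟩ | ⟨k, f, q⟩ | ⟨f, q⟩ | ⟨f, q₁, q₂⟩ | f | _ <;>
        rcases o with _ | g <;> simp [srcMul, tgtMul, vec, effect]
    · simp [srcMul, tgtMul, vec, hk]

end StackMachine

lemma Relation.EqvGen.reflTransGen_of_deterministic {α : Type*} {r : α → α → Prop}
    (hr : ∀ x y z, r x y → r x z → y = z) {z : α} (hz : ∀ y, r z y → y = z) {x : α}
    (h : EqvGen r x z) : ReflTransGen r x z := by
  have key : ∀ {x y}, EqvGen r x y → (ReflTransGen r x z ↔ ReflTransGen r y z) := by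
    intro x y hxy
    induction hxy with
    | rel x y hxy =>
      refine ⟨fun h => ?_, fun h => h.head hxy⟩
      rcases h.cases_head with rfl | ⟨w, hxw, hw⟩
      · rw [hz _ hxy]
      · rwa [hr _ _ _ hxy hxw]
    | refl => rfl
    | symm _ _ _ ih => exact ih.symm
    | trans _ _ _ _ _ ih₁ ih₂ => exact ih₁.trans ih₂
  exact (key h).2 .refl

namespace StackMachine

open Turing Turing.PartrecToTM2 Turing.TM2.Stmt

/-- The configuration about to execute the body of the current label. -/
def ofCfg : Cfg' → Config
  | ⟨some l, s, S⟩ => ((tr l, s), S)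
  | ⟨none, s, S⟩ => ((TM2.Stmt.halt, s), S)

lemma exists_iterate_next_eq_stepAux (q : Stmt') (s : Option Γ') (S : K' → List Γ') :
    ∃ n, next^[n] ((q, s), S) = ofCfg (TM2.stepAux q s S) := by
  induction q generalizing s S with
  | push k f q ih | peek k f q ih | pop k f q ih | load f q ih =>
    obtain ⟨n, hn⟩ := ih _ _
    exact ⟨n + 1, hn⟩
  | branch f q₁ q₂ ih₁ ih₂ =>
    have key : ∀ i : Bool, ∃ n, next^[n] ((cond i q₁ q₂, s), S) =
        ofCfg (cond i (TM2.stepAux q₁ s S) (TM2.stepAux q₂ s S)) := by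
      rintro (_ | _)
      exacts [ih₂ s S, ih₁ s S]
    obtain ⟨n, hn⟩ := key (f s)
    exact ⟨n + 1, hn⟩
  | goto f => exact ⟨1, rfl⟩
  | halt => exact ⟨0, rfl⟩

lemma exists_iterate_next_eq_of_reaches {b b' : Cfg'}
    (h : StateTransition.Reaches (TM2.step tr) b b') : ∃ n, next^[n] (ofCfg b) = ofCfg b' := by
  induction h with
  | refl => exact ⟨0, rfl⟩
  | @tail b' b'' _ hb ih =>
    obtain ⟨n, hn⟩ := ih
    obtain ⟨_ | l, s, S⟩ := b'
    · cases hb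
    · obtain ⟨m, hm⟩ := exists_iterate_next_eq_stepAux (tr l) s S
      obtain rfl : TM2.stepAux (tr l) s S = b'' := Option.some.inj hb
      exact ⟨m + n, (Function.iterate_add_apply ..).trans ((congrArg _ hn).trans hm)⟩

lemma eval_dom_of_iterate_next_eq_halt (n : ℕ) (q : Stmt') (s : Option Γ') (S : K' → List Γ')
    (h : (next^[n] ((q, s), S)).1.1 = TM2.Stmt.halt) :
    (StateTransition.eval (TM2.step tr) (TM2.stepAux q s S)).Dom := by
  induction n generalizing q s S with
  | zero =>
    obtain rfl : q = TM2.Stmt.halt := h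
    exact (StateTransition.mem_eval.2 ⟨.refl, rfl⟩).fst
  | succ n ih =>
    rcases q with ⟨k, f, q⟩ | ⟨k, f, q⟩ | ⟨k, f, q⟩ | ⟨f, q⟩ | ⟨f, q₁, q₂⟩ | f | _
    case goto =>
      have e := StateTransition.reaches_eval (f := TM2.step tr)
        (a := TM2.stepAux (goto f) s S) (b := TM2.stepAux (tr (f s)) s S) (.single rfl)
      exact (congrArg Part.Dom e).mpr (ih (tr (f s)) s S h)
    case branch =>
      have key : ∀ i : Bool, (next^[n] ((cond i q₁ q₂, s), S)).1.1 = TM2.Stmt.halt →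
          (StateTransition.eval (TM2.step tr)
            (cond i (TM2.stepAux q₁ s S) (TM2.stepAux q₂ s S))).Dom := by
        rintro (_ | _)
        exacts [ih q₂ s S, ih q₁ s S]
      exact key (f s) h
    case halt => exact (StateTransition.mem_eval.2 ⟨.refl, rfl⟩).fst
    all_goals exact ih q _ _ h

/-- The configuration in which the code `c` is started on the input `v`. -/
def start (c : ToPartrec.Code) (v : List ℕ) : Config :=
  ((tr (trNormal c .halt), none), K'.elim (trList v) [] [] [])

/-- The halted configuration with empty stacks. -/
def haltConfig : Config := ((TM2.Stmt.halt, none), fun _ => [])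

lemma exists_iterate_next_eq_haltConfig {c : ToPartrec.Code} {v : List ℕ}
    (hc : ∀ u ∈ c.eval v, u = []) (h : (c.eval v).Dom) :
    ∃ n, next^[n] (start c v) = haltConfig := by
  have hu := Part.get_mem h
  have hu' : PartrecToTM2.halt [] ∈ StateTransition.eval (TM2.step tr) (init c v) := by
    rw [tr_eval]
    exact Part.mem_map _ (hc _ hu ▸ hu)
  obtain ⟨n, hn⟩ := exists_iterate_next_eq_of_reaches (StateTransition.mem_eval.1 hu').1
  refine ⟨n, hn.trans ?_⟩
  have : K'.elim [] [] [] [] = fun _ => [] := by funext k; cases k <;> rfl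
  exact congrArg (fun S => ((TM2.Stmt.halt, none), S)) this

lemma eval_dom_iff (c : ToPartrec.Code) (v : List ℕ) :
    (StateTransition.eval (TM2.step tr) (TM2.stepAux (tr (trNormal c .halt)) none
      (K'.elim (trList v) [] [] []))).Dom ↔ (c.eval v).Dom := by
  have e := StateTransition.reaches_eval (f := TM2.step tr) (a := init c v)
    (b := TM2.stepAux (tr (trNormal c .halt)) none (K'.elim (trList v) [] [] [])) (.single rfl)
  rw [tr_eval] at e
  exact (congrArg Part.Dom e).symm.to_iff

/-- The statements occurring in the machine for the code `c`. -/
def stmtSet (c : ToPartrec.Code) : Set Stmt' :=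
  insert TM2.Stmt.halt <| ⋃ l ∈ codeSupp c .halt, {q | q ∈ TM2.stmts₁ (tr l)}

lemma mem_stmtSet {c : ToPartrec.Code} {q : Stmt'} :
    q ∈ stmtSet c ↔ q = TM2.Stmt.halt ∨ ∃ l ∈ codeSupp c .halt, q ∈ TM2.stmts₁ (tr l) :=
  Set.mem_insert_iff.trans (or_congr .rfl (by simp))

lemma finite_stmtSet (c : ToPartrec.Code) : (stmtSet c).Finite :=
  ((codeSupp c .halt).finite_toSet.biUnion fun l _ => (TM2.stmts₁ (tr l)).finite_toSet).insert _

lemma tr_mem_stmtSet {c : ToPartrec.Code} {l : Λ'} (h : l ∈ codeSupp c .halt) :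
    tr l ∈ stmtSet c :=
  mem_stmtSet.2 (.inr ⟨l, h, TM2.stmts₁_self⟩)

lemma start_mem_stmtSet (c : ToPartrec.Code) (v : List ℕ) : (start c v).1.1 ∈ stmtSet c :=
  tr_mem_stmtSet (tr_supports c .halt).1

lemma next_mem_stmtSet {c : ToPartrec.Code} {x : Config} (hx : x.1.1 ∈ stmtSet c) :
    (next x).1.1 ∈ stmtSet c := by
  classical
  have sub : ∀ {q q' : Stmt'}, q ∈ stmtSet c → q' ∈ TM2.stmts₁ q → q' ∈ stmtSet c := by
    intro q q' h h'
    obtain rfl | ⟨l, hl, hq⟩ := mem_stmtSet.1 h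
    · rwa [Finset.mem_singleton.1 h']
    · exact mem_stmtSet.2 (.inr ⟨l, hl, TM2.stmts₁_trans hq h'⟩)
  obtain ⟨⟨q, s⟩, S⟩ := x
  rcases q with ⟨k, f, q⟩ | ⟨k, f, q⟩ | ⟨k, f, q⟩ | ⟨f, q⟩ | ⟨f, q₁, q₂⟩ | f | _
  case branch =>
    have key : ∀ i : Bool, (cond i q₁ q₂) ∈ stmtSet c := by
      rintro (_ | _)
      · exact sub hx (Finset.mem_insert_of_mem (Finset.mem_union_right _ TM2.stmts₁_self))
      · exact sub hx (Finset.mem_insert_of_mem (Finset.mem_union_left _ TM2.stmts₁_self))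
    exact key _
  case goto =>
    obtain h | ⟨l, hl, hq⟩ := mem_stmtSet.1 hx
    · cases h
    exact tr_mem_stmtSet (TM2.stmts₁_supportsStmt_mono hq ((tr_supports c .halt).2 l hl) s)
  case halt => exact hx
  all_goals exact sub hx (Finset.mem_insert_of_mem TM2.stmts₁_self)

lemma exists_numbering (c : ToPartrec.Code) (st : State) :
    ∃ ι : State → ℤ, Set.InjOn ι {x | x.1 ∈ stmtSet c} ∧ ι st = 0 := by
  have hfin : {x : State | x.1 ∈ stmtSet c}.Finite := by
    refine ((finite_stmtSet c).prod (Set.finite_univ (α := Option Γ'))).subset fun x hx => ?_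
    exact ⟨hx, trivial⟩
  obtain ⟨e, he⟩ := Set.countable_iff_exists_injOn.1 hfin.countable
  exact ⟨fun x => e x - e st, fun x hx y hy h => he hx hy (by simpa using h), by simp⟩

section

variable {c : ToPartrec.Code} {ι : State → ℤ}

/-- The step relation of the system of affine maps of the machine for `c`. -/
def Step (c : ToPartrec.Code) (ι : State → ℤ) : (Option K' → ℤ) → (Option K' → ℤ) → Prop :=
  AffineStep (J := {x : State // x.1 ∈ stmtSet c} × Option Γ')
    (fun j => src ι j.1 j.2) (fun j => tgt ι j.1 j.2)
    (fun j => srcMul j.1 j.2) (fun j => tgtMul j.1 j.2)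

lemma step_iff_machineStep {w w' : Option K' → ℤ} :
    Step c ι w w' ↔ ∃ st o, st.1 ∈ stmtSet c ∧ MachineStep ι st o w w' := by
  simp only [Step, AffineStep, machineStep_iff]
  constructor
  · rintro ⟨⟨⟨st, hst⟩, o⟩, h⟩
    exact ⟨st, o, hst, h⟩
  · rintro ⟨st, o, hst, h⟩
    exact ⟨⟨⟨st, hst⟩, o⟩, h⟩

lemma step_unique (hι : Set.InjOn ι {x | x.1 ∈ stmtSet c}) {w w₁ w₂ : Option K' → ℤ}
    (h₁ : Step c ι w w₁) (h₂ : Step c ι w w₂) : w₁ = w₂ := by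
  rw [step_iff_machineStep] at h₁ h₂
  obtain ⟨st, o, hst, h₁⟩ := h₁
  obtain ⟨st', o', hst', h₂⟩ := h₂
  obtain rfl : st = st' := hι hst hst' (h₁.1.symm.trans h₂.1)
  exact machineStep_unique ι h₁ h₂

lemma step_next {x : Config} (hx : x.1.1 ∈ stmtSet c) :
    Step c ι (encodeConfig ι x) (encodeConfig ι (next x)) := by
  obtain ⟨o, h⟩ := machineStep_next ι x
  exact step_iff_machineStep.2 ⟨_, o, hx, h⟩

lemma haltConfig_mem_stmtSet (c : ToPartrec.Code) : haltConfig.1.1 ∈ stmtSet c :=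
  mem_stmtSet.2 (.inl rfl)

lemma eqvGen_step_iff (hι : Set.InjOn ι {x | x.1 ∈ stmtSet c}) {v : List ℕ}
    (hc : ∀ u ∈ c.eval v, u = []) :
    Relation.EqvGen (Step c ι) (encodeConfig ι (start c v)) (encodeConfig ι haltConfig) ↔
      (c.eval v).Dom := by
  constructor
  · intro h
    have hself : ∀ y, Step c ι (encodeConfig ι haltConfig) y →
        y = encodeConfig ι haltConfig := fun y hy =>
      step_unique hι hy (step_next (haltConfig_mem_stmtSet c))
    replace h := h.reflTransGen_of_deterministic (r := Step c ι) (fun _ _ _ => step_unique hι) hself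
    obtain ⟨n, hn, hn'⟩ : ∃ n, (next^[n] (start c v)).1.1 ∈ stmtSet c ∧
        encodeConfig ι haltConfig = encodeConfig ι (next^[n] (start c v)) := by
      generalize encodeConfig ι haltConfig = w at h
      induction h with
      | refl => exact ⟨0, start_mem_stmtSet c v, rfl⟩
      | tail _ hw ih =>
        obtain ⟨n, hn, rfl⟩ := ih
        refine ⟨n + 1, ?_, ?_⟩ <;> rw [Function.iterate_succ_apply']
        exacts [next_mem_stmtSet hn, step_unique hι hw (step_next hn)]
    have e : haltConfig.1 = (next^[n] (start c v)).1 :=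
      hι (haltConfig_mem_stmtSet c) hn (congrFun hn' none)
    have h' := eval_dom_of_iterate_next_eq_halt n (tr (trNormal c .halt)) none
      (K'.elim (trList v) [] [] []) (congrArg Prod.fst e).symm
    exact (eval_dom_iff c v).1 h'
  · intro h
    obtain ⟨n, hn⟩ := exists_iterate_next_eq_haltConfig hc h
    rw [← hn]
    have hx := start_mem_stmtSet c v
    generalize start c v = x at hx
    clear hn
    induction n generalizing x with
    | zero => exact .refl _
    | succ n ih =>
      exact .trans _ _ _ (.rel _ _ (step_next hx)) (ih _ (next_mem_stmtSet hx))

end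

end StackMachine

namespace StackMachine

open Turing Turing.PartrecToTM2

/-- The stack code of the input `2 ^ n`. -/
def inputCode (n : ℕ) : ℕ :=
  n.rec 14 fun _ N => 3 + 5 * N

lemma computable_inputCode : Computable inputCode := by
  have h : Primrec inputCode := by
    refine Primrec.nat_rec₁ 14 ?_
    exact Primrec.nat_add.comp (Primrec.const 3)
      (Primrec.nat_mul.comp (Primrec.const 5) Primrec.snd)
  exact h.to_comp

lemma trNat_two_pow_succ (n : ℕ) : trNat (2 ^ (n + 1)) = .bit0 :: trNat (2 ^ n) := by
  obtain ⟨p, hp⟩ : ∃ p, ((2 ^ n : ℕ) : Num) = Num.pos p := by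
    rcases h : ((2 ^ n : ℕ) : Num) with _ | p
    · have := Num.to_of_nat (2 ^ n)
      rw [h] at this
      exact absurd this (pow_pos two_pos n).ne
    · exact ⟨p, rfl⟩
  have : ((2 ^ (n + 1) : ℕ) : Num) = Num.pos p.bit0 := by
    rw [pow_succ, mul_two, Nat.cast_add, hp, Num.bit0_of_bit0]
    rfl
  rw [trNat, trNat, hp, this]
  rfl

lemma stackCode_trList_two_pow (n : ℕ) : stackCode (trList [2 ^ n]) = inputCode n := by
  simp only [trList]
  induction n with
  | zero =>
    have : trNat (2 ^ 0) = [Γ'.bit1] := by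
      rw [trNat, pow_zero, Nat.cast_one]
      rfl
    rw [this]
    rfl
  | succ n ih =>
    rw [trNat_two_pow_succ, List.cons_append, stackCode, ih]
    simp [inputCode, digit]

lemma exists_code_dom_iff :
    ∃ c : ToPartrec.Code, (∀ v, ∀ u ∈ c.eval v, u = []) ∧
      ∀ d : Nat.Partrec.Code, (c.eval [2 ^ Encodable.encode d]).Dom ↔ (d.eval 0).Dom := by
  let g : ℕ →. ℕ := fun m =>
    (Nat.rfind fun j => Part.some (decide (2 ^ j = m))).bind fun j =>
      (Denumerable.ofNat Nat.Partrec.Code j).eval 0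
  have hg : Partrec g := by
    have hpow : Primrec fun j : ℕ => 2 ^ j := by
      have : Primrec fun n : ℕ => (n.rec 1 fun _ N => N * 2 : ℕ) :=
        Primrec.nat_rec₁ 1 (Primrec.nat_mul.comp Primrec.snd (Primrec.const 2))
      refine this.of_eq fun n => ?_
      induction n with
      | zero => rfl
      | succ n ih => rw [pow_succ, ← ih]
    refine Partrec.bind (Partrec.rfind ?_) ?_
    · have : PrimrecPred fun p : ℕ × ℕ => 2 ^ p.2 = p.1 :=
        Primrec.eq.comp (hpow.comp Primrec.snd) Primrec.fst
      exact this.decide.to_comp.partrec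
    · exact Nat.Partrec.Code.eval_part.comp
        ((Computable.ofNat _).comp Computable.snd) (Computable.const 0)
  obtain ⟨c, hc⟩ := ToPartrec.Code.exists_code (Nat.Partrec'.part_iff₁.2 hg)
  refine ⟨.comp .nil c, fun v u hu => ?_, fun d => ?_⟩
  · rw [ToPartrec.Code.comp_eval] at hu
    obtain ⟨_, _, h⟩ := Part.mem_bind_iff.1 hu
    rw [ToPartrec.Code.nil_eval] at h
    exact Part.mem_some_iff.1 h
  · have e : c.eval [2 ^ Encodable.encode d] = pure <$> g (2 ^ Encodable.encode d) :=
      hc ⟨[2 ^ Encodable.encode d], rfl⟩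
    have hg' : g (2 ^ Encodable.encode d) = d.eval 0 := by
      have : Encodable.encode d ∈ Nat.rfind fun j =>
          Part.some (decide (2 ^ j = 2 ^ Encodable.encode d)) := by
        refine Nat.mem_rfind.2 ⟨by simp, fun {k} hk => ?_⟩
        have : ¬ k = Encodable.encode d := hk.ne
        simp [this]
      simp only [g]
      rw [Part.eq_some_iff.2 this]
      simp
    rw [ToPartrec.Code.comp_eval]
    change (c.eval _ >>= _).Dom ↔ _
    rw [e, hg']
    exact ⟨fun h => h.fst, fun h =>
      ⟨h, (congrArg Part.Dom (ToPartrec.Code.nil_eval _)).mpr trivial⟩⟩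

instance : Finite K' :=
  Finite.of_injective (fun k : K' => match k with
    | .main => (0 : Fin 4) | .rev => 1 | .aux => 2 | .stack => 3)
    fun x y => by cases x <;> cases y <;> simp

/-- There is a finite system of partial affine maps such that no algorithm decides which points
of a ray are equivalent to a given point. -/
theorem exists_undecidable_affineStep :
    ∃ (J D : Type) (_ : Finite J) (_ : Finite D) (_ : DecidableEq D) 
      (a b m m' : J → D → ℤ) (e : D) (w : D → ℤ),
      (∀ j i, m j i = 0 ↔ m' j i = 0) ∧
      ¬ ∃ f : ℕ → Bool, Computable f ∧ ∀ n : ℕ,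
        f n = true ↔ Relation.EqvGen (AffineStep a b m m') (Pi.single e (n : ℤ)) w := by
  obtain ⟨c, hc, hdom⟩ := exists_code_dom_iff
  obtain ⟨ι, hι, hι0⟩ := exists_numbering c (tr (trNormal c .halt), none)
  have hfin : Finite {x : State // x.1 ∈ stmtSet c} :=
    ((finite_stmtSet c).prod (Set.finite_univ (α := Option Γ'))).subset fun x hx => ⟨hx, trivial⟩
  refine ⟨{x : State // x.1 ∈ stmtSet c} × Option Γ', Option K', inferInstance, inferInstance,
    inferInstance,
    fun j => src ι j.1 j.2, fun j => tgt ι j.1 j.2, fun j => srcMul j.1 j.2,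
    fun j => tgtMul j.1 j.2, some .main, encodeConfig ι haltConfig,
    fun j i => srcMul_eq_zero_iff j.1 j.2 i, ?_⟩
  rintro ⟨f, hf, h⟩
  refine ComputablePred.halting_problem 0 (ComputablePred.computable_iff.2
    ⟨fun d => f (inputCode (Encodable.encode d)),
      hf.comp (computable_inputCode.comp Computable.encode), ?_⟩)
  funext d
  have henc : encodeConfig ι (start c [2 ^ Encodable.encode d]) =
      Pi.single (some K'.main) (inputCode (Encodable.encode d) : ℤ) := by
    rw [← stackCode_trList_two_pow]
    funext i
    rcases i with _ | k
    · simpa [encodeConfig, start, vec] using hι0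
    · cases k <;> simp [encodeConfig, start, vec, stackCode]
  rw [eq_iff_iff, h, ← henc, ← hdom]
  exact (eqvGen_step_iff hι (hc _)).symm

end StackMachine

section Monomial

variable {D H H' : Type*} [Group H] [Group H'] [Fintype D]

/-- The product of the powers `x i ^ w i`. -/
noncomputable def monomial (x : D → H) (w : D → ℤ) : H :=
  (Finset.univ.toList.map fun i => x i ^ w i).prod

lemma map_monomial (φ : H →* H') (x : D → H) (w : D → ℤ) :
    φ (monomial x w) = monomial (fun i => φ (x i)) w := by
  simp [monomial, map_list_prod, Function.comp_def]

lemma monomial_semiconjBy {x : D → H} {s : H} {v w : D → ℤ}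
    (h : ∀ i, SemiconjBy s (x i ^ v i) (x i ^ w i)) :
    SemiconjBy s (monomial x v) (monomial x w) := by
  unfold monomial
  induction (Finset.univ : Finset D).toList with
  | nil => simp
  | cons i l ih => simpa using (h i).mul_right ih

lemma monomial_add {x : D → H} (hx : ∀ i l, Commute (x i) (x l)) (v w : D → ℤ) :
    monomial x (v + w) = monomial x v * monomial x w := by
  unfold monomial
  induction (Finset.univ : Finset D).toList with
  | nil => simp
  | cons i l ih =>
    have hc : Commute (x i ^ w i) (l.map fun i => x i ^ v i).prod :=
      Commute.list_prod_right _ _ fun y hy => by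
        obtain ⟨l', -, rfl⟩ := List.mem_map.1 hy
        exact (hx i l').zpow_zpow _ _
    simp only [List.map_cons, List.prod_cons, Pi.add_apply, zpow_add] at ih ⊢
    rw [ih, mul_assoc, ← mul_assoc _ _ (List.prod _), hc.eq]
    simp only [mul_assoc]

lemma monomial_single [DecidableEq D] (x : D → H) (e : D) (n : ℤ) :
    monomial x (Pi.single e n) = x e ^ n := by
  have key : ∀ l : List D, l.Nodup →
      (l.map fun i => x i ^ (Pi.single e n : D → ℤ) i).prod = if e ∈ l then x e ^ n else 1 := by
    intro l hl
    induction l with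
    | nil => simp
    | cons i l ih =>
      rw [List.nodup_cons] at hl
      rw [List.map_cons, List.prod_cons, ih hl.2]
      by_cases hi : e = i
      · subst hi; simp [hl.1]
      · simp [hi, Ne.symm hi]
  simpa [monomial] using key _ Finset.univ.nodup_toList

end Monomial

lemma minFac_orderOf_lt {H : Type*} [Group H] {a b : H} (ha : IsOfFinOrder a)
    (h : b * a = a * b ^ 2) (hb1 : b ≠ 1) :
    (orderOf a).minFac < (orderOf b).minFac := by
  set p := (orderOf b).minFac with hp
  have hpp : p.Prime := Nat.minFac_prime (by simpa using hb1)
  have := Fact.mk hpp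
  have hpow : ∀ k : ℕ, b * a ^ k = a ^ k * b ^ 2 ^ k := by
    intro k
    induction k with
    | zero => simp
    | succ k ih =>
      have h' : b ^ 2 ^ k * a = a * (b ^ 2) ^ 2 ^ k :=
        (SemiconjBy.pow_right (a := a) (x := b ^ 2) (y := b) h.symm (2 ^ k)).symm
      rw [pow_succ a, ← mul_assoc, ih, mul_assoc, h', ← pow_mul, mul_assoc, pow_succ' 2]
  have h1 : b ^ 2 ^ orderOf a = b := by
    simpa [pow_orderOf_eq_one] using (hpow (orderOf a)).symm
  have hdvd : orderOf b ∣ 2 ^ orderOf a - 1 := by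
    apply orderOf_dvd_of_pow_eq_one
    have : b ^ (2 ^ orderOf a - 1) * b = b := by
      rw [← pow_succ, Nat.sub_add_cancel Nat.one_le_two_pow, h1]
    simpa using this
  have hpd : p ∣ 2 ^ orderOf a - 1 := (Nat.minFac_dvd _).trans hdvd
  have h2 : (2 : ZMod p) ^ orderOf a = 1 := by
    have := (ZMod.natCast_eq_zero_iff _ _).2 hpd
    rw [Nat.cast_sub Nat.one_le_two_pow] at this
    simpa [sub_eq_zero] using this
  have h20 : (2 : ZMod p) ≠ 0 := by
    intro h0
    rw [h0, zero_pow ha.orderOf_pos.ne'] at h2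
    exact zero_ne_one h2
  have hg : Nat.gcd (orderOf a) (p - 1) ≠ 1 := by
    intro hg
    have h3 : (2 : ZMod p) ^ Nat.gcd (orderOf a) (p - 1) = 1 :=
      pow_gcd_eq_one.2 ⟨h2, ZMod.pow_card_sub_one_eq_one h20⟩
    rw [hg, pow_one] at h3
    have : (1 : ZMod p) = 0 := by linear_combination h3
    exact one_ne_zero this
  calc (orderOf a).minFac ≤ (Nat.gcd (orderOf a) (p - 1)).minFac :=
        Nat.minFac_le_of_dvd (Nat.minFac_prime hg).two_le
          ((Nat.minFac_dvd _).trans (Nat.gcd_dvd_left _ _))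
    _ ≤ p - 1 := Nat.le_of_dvd (Nat.sub_pos_of_lt hpp.one_lt)
          ((Nat.minFac_dvd _).trans (Nat.gcd_dvd_right _ _))
    _ < p := Nat.sub_lt hpp.pos one_pos

/-- Higman's four-cycle of relations has no nontrivial solutions of finite order. -/
lemma eq_one_of_higman_cycle {H : Type*} [Group H] [Finite H] {a b c d : H}
    (hab : b * a = a * b ^ 2) (hbc : c * b = b * c ^ 2) (hcd : d * c = c * d ^ 2)
    (hda : a * d = d * a ^ 2) : a = 1 := by
  by_contra ha
  have fin : ∀ z : H, IsOfFinOrder z := isOfFinOrder_of_finite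
  have step : ∀ {y z : H}, z * y = y * z ^ 2 → z ≠ 1 →
      y ≠ 1 ∧ (orderOf y).minFac < (orderOf z).minFac := by
    intro y z h hz
    refine ⟨?_, minFac_orderOf_lt (fin _) h hz⟩
    rintro rfl
    exact hz (by simpa [pow_two] using h)
  obtain ⟨hd, h1⟩ := step hda ha
  obtain ⟨hc, h2⟩ := step hcd hd
  obtain ⟨hb, h3⟩ := step hbc hc
  obtain ⟨-, h4⟩ := step hab hb
  omega

/-- Generators of the group simulating a system of affine maps. -/
inductive BaseGen (J D : Type) : Type
  | x (i : D)
  | s (j : J)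
  | t
  | k

/-- Generators of the perfect group containing the simulating group. -/
inductive Gen (J D : Type) : Type
  | base (g : BaseGen J D)
  | y
  | u
  | e
  | q
  | p (g : Option (BaseGen J D))

instance {J D : Type} [Finite J] [Finite D] : Finite (BaseGen J D) :=
  Finite.of_surjective (fun z : (D ⊕ J) ⊕ Bool => match z with
    | .inl (.inl i) => .x i
    | .inl (.inr j) => .s j
    | .inr false => .t
    | .inr true => .k) (by
      rintro (i | j | _ | _)
      exacts [⟨.inl (.inl i), rfl⟩, ⟨.inl (.inr j), rfl⟩, ⟨.inr false, rfl⟩, ⟨.inr true, rfl⟩])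

instance {J D : Type} [Finite J] [Finite D] : Finite (Gen J D) :=
  Finite.of_surjective (fun z : (BaseGen J D ⊕ Option (BaseGen J D)) ⊕ Fin 4 => match z with
    | .inl (.inl g) => .base g
    | .inl (.inr g) => .p g
    | .inr 0 => .y
    | .inr 1 => .u
    | .inr 2 => .e
    | .inr 3 => .q) (by
      rintro (g | _ | _ | _ | _ | g)
      exacts [⟨.inl (.inl g), rfl⟩, ⟨.inr 0, rfl⟩, ⟨.inr 1, rfl⟩, ⟨.inr 2, rfl⟩, ⟨.inr 3, rfl⟩,
        ⟨.inl (.inr g), rfl⟩])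

section Relations

variable {H H' : Type*} [Group H] [Group H'] {J D : Type}

/-- The elements `y` and `g * y`, for generators `g` of the simulating group. -/
def twisted (f : Gen J D → H) : Option (BaseGen J D) → H
  | none => f .y
  | some g => f (.base g) * f .y

lemma map_twisted (φ : H →* H') (f : Gen J D → H) (o : Option (BaseGen J D)) :
    φ (twisted f o) = twisted (fun g => φ (f g)) o := by
  cases o <;> simp [twisted]

variable [Fintype D]

/-- The conjugate of the element `t` by the monomial with exponent vector `w`. -/
noncomputable def pointer (f : BaseGen J D → H) (w : D → ℤ) : H :=
  (monomial (fun i => f (.x i)) w)⁻¹ * f .t * monomial (fun i => f (.x i)) w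

lemma map_pointer (φ : H →* H') (f : BaseGen J D → H) (w : D → ℤ) :
    φ (pointer f w) = pointer (fun g => φ (f g)) w := by
  simp [pointer, map_monomial]

/-- The relations of the simulating group. -/
structure BaseRel (a b m m' : J → D → ℤ) (w : D → ℤ) (f : BaseGen J D → H) : Prop where
  x_x : ∀ i l, f (.x i) * f (.x l) = f (.x l) * f (.x i)
  x_s : ∀ j i, f (.x i) ^ m j i * f (.s j) = f (.s j) * f (.x i) ^ m' j i
  t_s : ∀ j, pointer f (a j) * f (.s j) = f (.s j) * pointer f (b j)
  k_t : f .k * pointer f w = pointer f w * f .k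
  k_s : ∀ j, f .k * f (.s j) = f (.s j) * f .k

/-- The relations of the perfect group containing the simulating group. -/
structure GenRel (a b m m' : J → D → ℤ) (w : D → ℤ) (f : Gen J D → H) : Prop where
  base : BaseRel a b m m' w fun g => f (.base g)
  u_eq : f .u = (f (.base .k))⁻¹ * ((f .e)⁻¹ * f (.base .t) * f .e)⁻¹ *
    f (.base .k) * ((f .e)⁻¹ * f (.base .t) * f .e)
  p_u : ∀ o, f (.p o) * f .u = f .u * f (.p o) ^ 2
  y_p : ∀ o, twisted f o * f (.p o) = f (.p o) * twisted f o ^ 2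
  q_y : f .q * f .y = f .y * f .q ^ 2
  u_q : f .u * f .q = f .q * f .u ^ 2

variable {a b m m' : J → D → ℤ} {w : D → ℤ}

lemma BaseRel.map {f : BaseGen J D → H} (h : BaseRel a b m m' w f) (φ : H →* H') :
    BaseRel a b m m' w fun g => φ (f g) where
  x_x i l := by simp only [← map_mul, h.x_x]
  x_s j i := by simp only [← map_mul, ← map_zpow, h.x_s]
  t_s j := by simp only [← map_pointer, ← map_mul, h.t_s]
  k_t := by simp only [← map_pointer, ← map_mul, h.k_t]
  k_s j := by simp only [← map_mul, h.k_s]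

lemma GenRel.map {f : Gen J D → H} (h : GenRel a b m m' w f) (φ : H →* H') :
    GenRel a b m m' w fun g => φ (f g) where
  base := h.base.map φ
  u_eq := by rw [h.u_eq]; simp
  p_u o := by simp only [← map_mul, ← map_pow, h.p_u]
  y_p o := by simp only [← map_twisted, ← map_mul, ← map_pow, h.y_p]
  q_y := by simp only [← map_mul, ← map_pow, h.q_y]
  u_q := by simp only [← map_mul, ← map_pow, h.u_q]

lemma BaseRel.commute_pointer {f : BaseGen J D → H} (h : BaseRel a b m m' w f) {v : D → ℤ}
    (hv : Relation.EqvGen (AffineStep a b m m') v w) : Commute (f .k) (pointer f v) := by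
  have key : ∀ {v v'}, Relation.EqvGen (AffineStep a b m m') v v' →
      (Commute (f .k) (pointer f v) ↔ Commute (f .k) (pointer f v')) := by
    intro v v' hvv'
    induction hvv' with
    | rel v v' hvv' =>
      obtain ⟨j, z, rfl, rfl⟩ := hvv'
      have hx : ∀ i l, Commute (f (.x i)) (f (.x l)) := h.x_x
      have hs : SemiconjBy (f (.s j)) (monomial (fun i => f (.x i)) (m' j * z))
          (monomial (fun i => f (.x i)) (m j * z)) := by
        refine monomial_semiconjBy fun i => ?_
        have : SemiconjBy (f (.s j)) (f (.x i) ^ m' j i) (f (.x i) ^ m j i) := (h.x_s j i).symm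
        simpa [zpow_mul] using this.zpow_right (z i)
      have ht : SemiconjBy (f (.s j)) (pointer f (b j + m' j * z)) (pointer f (a j + m j * z)) := by
        have ht : SemiconjBy (f (.s j)) (pointer f (b j)) (pointer f (a j)) := (h.t_s j).symm
        have e : ∀ c d, pointer f (c + d) = (monomial (fun i => f (.x i)) d)⁻¹ * pointer f c *
            monomial (fun i => f (.x i)) d := by
          intro c d
          simp only [pointer, monomial_add hx, mul_inv_rev, mul_assoc]
        rw [e, e]
        exact (hs.inv_right.mul_right ht).mul_right hs
      have hk : Commute (f .k) (f (.s j)) := h.k_s j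
      have e : pointer f (a j + m j * z) =
          f (.s j) * pointer f (b j + m' j * z) * (f (.s j))⁻¹ := by
        rw [ht.eq, mul_inv_cancel_right]
      have e' : pointer f (b j + m' j * z) =
          (f (.s j))⁻¹ * pointer f (a j + m j * z) * f (.s j) := by
        rw [mul_assoc, ← ht.eq, inv_mul_cancel_left]
      constructor
      · intro hc
        rw [e']
        exact (hk.inv_right.mul_right hc).mul_right hk
      · intro hc
        rw [e]
        exact (hk.mul_right hc).mul_right hk.inv_right
    | refl => rfl
    | symm _ _ _ ih => exact ih.symm
    | trans _ _ _ _ _ ih₁ ih₂ => exact ih₁.trans ih₂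
  exact (key hv).2 h.k_t

lemma GenRel.eq_one_of_u_eq_one {f : Gen J D → H} (h : GenRel a b m m' w f) {e : D} {n : ℕ}
    (he : f .e = f (.base (.x e)) ^ n) (hu : f .u = 1) (g : Gen J D) : f g = 1 := by
  have hp : ∀ o, f (.p o) = 1 := fun o => by simpa [hu, pow_two] using h.p_u o
  have ht : ∀ o, twisted f o = 1 := fun o => by simpa [hp, pow_two] using h.y_p o
  have hy : f .y = 1 := ht none
  have hb : ∀ g, f (.base g) = 1 := fun g => by simpa [twisted, hy] using ht (some g)
  rcases g with g | _ | _ | _ | _ | o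
  · exact hb g
  · exact hy
  · exact hu
  · rw [he, hb, one_pow]
  · simpa [hy, pow_two] using h.q_y
  · exact hp o

lemma GenRel.u_eq_one_of_finite [Finite H] {f : Gen J D → H} (h : GenRel a b m m' w f) : f .u = 1 :=
  eq_one_of_higman_cycle (h.p_u none) (h.y_p none) h.q_y h.u_q

lemma GenRel.u_eq_one_of_comm {H : Type*} [CommGroup H] {f : Gen J D → H}
    (h : GenRel a b m m' w f) : f .u = 1 := by
  have := h.u_q
  rw [mul_comm, pow_two] at this
  simpa using this

lemma GenRel.u_eq_one_of_eqvGen [DecidableEq D] {f : Gen J D → H} (h : GenRel a b m m' w f) {e : D}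
    {n : ℕ} (he : f .e = f (.base (.x e)) ^ n)
    (hn : Relation.EqvGen (AffineStep a b m m') (Pi.single e (n : ℤ)) w) : f .u = 1 := by
  have hc := h.base.commute_pointer hn
  rw [pointer, monomial_single, zpow_natCast, ← he] at hc
  rw [h.u_eq, mul_assoc, hc.eq]
  group

end Relations

lemma H2.ker_inf_commutator_le {Q : Type*} [Group Q] (h : ¬ Nontrivial (H2 Q)) :
    (FreeGroup.lift (id : Q → Q)).ker ⊓ commutator (FreeGroup Q) ≤
      ⁅(⊤ : Subgroup (FreeGroup Q)), (FreeGroup.lift (id : Q → Q)).ker⁆ := by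
  rw [not_nontrivial_iff_subsingleton] at h
  rw [← Subgroup.subgroupOf_eq_top]
  exact QuotientGroup.subgroup_eq_top_of_subsingleton _ h

/-- A perfect group with trivial second homology lifts along central extensions. -/
lemma H2.exists_lift {Q E : Type*} [Group Q] [Group E] (hQ : commutator Q = ⊤)
    (h : ¬ Nontrivial (H2 Q)) {N : Subgroup E} [N.Normal] (hN : N ≤ Subgroup.center E)
    (φ : Q →* E ⧸ N) : ∃ σ : Q →* E, ∀ q, (σ q : E ⧸ N) = φ q := by
  let π : FreeGroup Q →* Q := FreeGroup.lift id
  let ℓ : FreeGroup Q →* E := FreeGroup.lift fun q => (φ q).out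
  have hℓ : ∀ x, (ℓ x : E ⧸ N) = φ (π x) := by
    intro x
    have : (QuotientGroup.mk' N).comp ℓ = φ.comp π := by
      ext q
      simp [ℓ, π]
    exact DFunLike.congr_fun this x
  have hker : ⁅(⊤ : Subgroup (FreeGroup Q)), π.ker⁆ ≤ ℓ.ker := by
    rw [Subgroup.commutator_le]
    intro x _ r hr
    have hr' : ℓ r ∈ N := by
      rw [← QuotientGroup.eq_one_iff, hℓ, MonoidHom.mem_ker.1 hr, map_one]
    rw [MonoidHom.mem_ker, map_commutatorElement, commutatorElement_eq_one_iff_mul_comm]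
    exact (Subgroup.mem_center_iff.1 (hN hr')) _
  let C := commutator (FreeGroup Q)
  let πC : C →* Q := π.comp C.subtype
  have hsurj : Function.Surjective πC := by
    intro q
    have hmap : C.map π = commutator Q := by
      simp only [C, commutator_def, Subgroup.map_commutator, Subgroup.map_top_of_surjective π
        (FreeGroup.lift_surjective_of_surjective Function.surjective_id)]
    obtain ⟨x, hx, rfl⟩ : q ∈ C.map π := by rw [hmap, hQ]; trivial
    exact ⟨⟨x, hx⟩, rfl⟩
  have hle : πC.ker ≤ (ℓ.comp C.subtype).ker := fun x hx =>
    hker (H2.ker_inf_commutator_le h ⟨hx, x.2⟩)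
  refine ⟨πC.liftOfSurjective hsurj ⟨ℓ.comp C.subtype, hle⟩, fun q => ?_⟩
  obtain ⟨x, rfl⟩ := hsurj q
  have := MonoidHom.liftOfRightInverse_comp_apply πC _
    (Function.rightInverse_surjInv hsurj) ⟨ℓ.comp C.subtype, hle⟩ x
  rw [MonoidHom.liftOfSurjective, this]
  exact hℓ x

open commutatorElement in
/-- Homomorphisms from a perfect group agreeing modulo a central subgroup are equal. -/
lemma MonoidHom.eq_of_commutator_eq_top {Γ E : Type*} [Group Γ] [Group E]
    (hΓ : commutator Γ = ⊤) {N : Subgroup E} (hN : N ≤ Subgroup.center E) {α β : Γ →* E}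
    (h : ∀ g, (α g : E ⧸ N) = β g) : α = β := by
  have hc : commutator Γ ≤ α.eqLocus β := by
    rw [commutator_def, Subgroup.commutator_le]
    intro g _ k _
    obtain ⟨z, hz, hgz⟩ : ∃ z ∈ Subgroup.center E, β g = α g * z :=
      ⟨(α g)⁻¹ * β g, hN (QuotientGroup.eq.1 (h g)), by group⟩
    obtain ⟨y, hy, hky⟩ : ∃ y ∈ Subgroup.center E, β k = α k * y :=
      ⟨(α k)⁻¹ * β k, hN (QuotientGroup.eq.1 (h k)), by group⟩
    change α ⁅g, k⁆ = β ⁅g, k⁆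
    have hz' := Subgroup.mem_center_iff.1 hz
    have hy' := Subgroup.mem_center_iff.1 hy
    rw [map_commutatorElement, map_commutatorElement, hgz, hky, commutatorElement_def,
      commutatorElement_def]
    have e1 : α g * z * (α k * y) = α g * α k * (y * z) := by
      rw [mul_assoc, ← mul_assoc z, ← hz' (α k), mul_assoc, mul_assoc, ← hz' y]
    have e2 : (α g * z)⁻¹ * (α k * y)⁻¹ = (y * z)⁻¹ * ((α g)⁻¹ * (α k)⁻¹) := by
      rw [← mul_inv_rev, ← mul_inv_rev, ← mul_inv_rev]
      congr 1
      rw [mul_assoc, ← mul_assoc y, ← hy' (α g), mul_assoc, mul_assoc]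
    rw [e1, mul_assoc _ _ (α k * y)⁻¹, e2]
    group
  ext g
  have : g ∈ commutator Γ := by rw [hΓ]; trivial
  exact hc this

lemma exists_cocycle {M : Type*} [Group M] {u : M} (hu : ¬ IsOfFinOrder u) :
    ∃ c : M → ℤ, ∀ g, c (u * g) = c g + 1 := by
  have hinj : Function.Injective fun n : ℤ => u ^ n :=
    injective_zpow_iff_not_isOfFinOrder.2 hu
  let r := QuotientGroup.rightRel (Subgroup.zpowers u)
  have hrep : ∀ g : M, ∃ n : ℤ, g = u ^ n * (Quotient.mk r g).out := by
    intro g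
    have h : r (Quotient.mk r g).out g := Quotient.exact (Quotient.out_eq _)
    obtain ⟨n, hn⟩ := QuotientGroup.rightRel_apply.1 h
    exact ⟨n, by simp only at hn; rw [hn]; group⟩
  choose c hc using hrep
  refine ⟨c, fun g => hinj ?_⟩
  have hq : Quotient.mk r (u * g) = Quotient.mk r g := by
    refine Quotient.sound (QuotientGroup.rightRel_apply.2 ⟨-1, ?_⟩)
    simp
  have h1 : u ^ c (u * g) * (Quotient.mk r g).out = u ^ (1 + c g) * (Quotient.mk r g).out := by
    rw [zpow_one_add, mul_assoc, ← hc g, ← hq, ← hc (u * g)]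
  rw [add_comm (c g)]
  exact mul_right_cancel h1

/-- Two copies of a group can be mapped to a common group in such a way that the images of an
element of infinite order differ by a nontrivial central element. -/
lemma exists_central_twist {M : Type} [Group M] {u : M} (hu : ¬ IsOfFinOrder u) :
    ∃ (E : Type) (_ : Group E) (i₁ i₂ : M →* E) (z : E),
      z ∈ Subgroup.center E ∧ z ≠ 1 ∧ i₂ u = i₁ u * z := by
  obtain ⟨c, hc⟩ := exists_cocycle hu
  let shift : Equiv.Perm (M × ℤ) := (Equiv.refl M).prodCongr (Equiv.addRight 1)
  let E := Subgroup.centralizer ({shift} : Set (Equiv.Perm (M × ℤ)))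
  have memE : ∀ σ : Equiv.Perm (M × ℤ), (∀ g n, σ (g, n + 1) = shift (σ (g, n))) → σ ∈ E := by
    intro σ hσ
    rw [Subgroup.mem_centralizer_singleton_iff]
    ext1 ⟨g, n⟩
    exact hσ g n
  let i₁ : M →* E :=
    { toFun g := ⟨(Equiv.mulLeft g).prodCongr (Equiv.refl ℤ), memE _ fun _ _ => rfl⟩
      map_one' := by ext x <;> simp
      map_mul' g h := by ext x <;> simp [mul_assoc] }
  let π : E := ⟨⟨fun x => (x.1, x.2 + c x.1), fun x => (x.1, x.2 - c x.1), fun x => by simp,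
    fun x => by simp⟩, memE _ fun g n => by simp [shift]; ring⟩
  let z : E := ⟨shift, memE _ fun _ _ => rfl⟩
  refine ⟨E, inferInstance, i₁, (MulAut.conj π).toMonoidHom.comp i₁, z, ?_, ?_, ?_⟩
  · refine Subgroup.mem_center_iff.2 fun σ => Subtype.ext ?_
    exact Subgroup.mem_centralizer_singleton_iff.1 σ.2
  · intro h
    have := congrArg (fun σ : E => (σ.1 (1, 0)).2) h
    simp [z, shift] at this
  · have : π * i₁ u = i₁ u * z * π := by
      refine Subtype.ext (Equiv.ext fun x => Prod.ext rfl ?_)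
      change x.2 + c (u * x.1) = x.2 + c x.1 + 1
      rw [hc]; ring
    simp [this]

/-- A perfect amalgam of two copies of a perfect group along an element that has infinite order in
some quotient has nontrivial second homology. -/
theorem H2.nontrivial_of_double {Q Γ M : Type} [Group Q] [Group Γ] [Group M]
    (hQ : commutator Q = ⊤) (hΓ : commutator Γ = ⊤) (j₁ j₂ : Γ →* Q) (u : Γ) (hj : j₁ u = j₂ u)
    (hdesc : ∀ (G : Type) [Group G] (α β : Γ →* G), α u = β u →
      ∃ φ : Q →* G, φ.comp j₁ = α ∧ φ.comp j₂ = β)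
    (f : Γ →* M) (hf : ¬ IsOfFinOrder (f u)) : Nontrivial (H2 Q) := by
  by_contra hH
  obtain ⟨E, _, i₁, i₂, z, hz, hz1, hu⟩ := exists_central_twist hf
  have hN : Subgroup.zpowers z ≤ Subgroup.center E := by simpa using hz
  have : (Subgroup.zpowers z).Normal := ⟨fun x hx g => by
    rw [(Subgroup.mem_center_iff.1 (hN hx) g), mul_inv_cancel_right]; exact hx⟩
  let mk := QuotientGroup.mk' (Subgroup.zpowers z)
  obtain ⟨φ, hφ₁, hφ₂⟩ := hdesc _ (mk.comp (i₁.comp f)) (mk.comp (i₂.comp f)) <| by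
    simp only [MonoidHom.comp_apply, hu, map_mul]
    have : mk z = 1 := (QuotientGroup.eq_one_iff z).2 (Subgroup.mem_zpowers z)
    rw [this, mul_one]
  obtain ⟨σ, hσ⟩ := H2.exists_lift hQ hH hN φ
  have h₁ : σ.comp j₁ = i₁.comp f := MonoidHom.eq_of_commutator_eq_top hΓ hN fun g =>
    (hσ _).trans (DFunLike.congr_fun hφ₁ g)
  have h₂ : σ.comp j₂ = i₂.comp f := MonoidHom.eq_of_commutator_eq_top hΓ hN fun g =>
    (hσ _).trans (DFunLike.congr_fun hφ₂ g)
  have e : i₁ (f u) = i₂ (f u) := by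
    have e₁ := DFunLike.congr_fun h₁ u
    have e₂ := DFunLike.congr_fun h₂ u
    simp only [MonoidHom.comp_apply] at e₁ e₂
    rw [← e₁, ← e₂, hj]
  rw [hu] at e
  exact hz1 (by simpa using e)

section FreeSubgroup

open Monoid

lemma FreeGroup.exists_zpow_eq (x : FreeGroup Unit) : ∃ n : ℤ, x = FreeGroup.of () ^ n :=
  ⟨FreeGroup.freeGroupUnitEquivInt x, (FreeGroup.freeGroupUnitEquivInt.symm_apply_apply x).symm⟩

/-- Elements of distinct factors of an amalgamated product whose nontrivial powers lie outside the
base group generate a free group. -/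
lemma Monoid.PushoutI.lift_of_injective {ι K : Type*} {G : ι → Type*} [∀ i, Group (G i)] [Group K]
    {φ : ∀ i, K →* G i} (hφ : ∀ i, Function.Injective (φ i)) (g : ∀ i, G i)
    (hg : ∀ i (n : ℤ), g i ^ n ∈ (φ i).range → n = 0) :
    Function.Injective (FreeGroup.lift fun i => PushoutI.of (φ := φ) i (g i)) := by
  classical
  let ψ : ∀ i, FreeGroup Unit →* G i := fun i => FreeGroup.lift fun _ => g i
  have hψ : ∀ i x, ψ i x ∈ (φ i).range → x = 1 := by
    intro i x hx
    obtain ⟨n, rfl⟩ := FreeGroup.exists_zpow_eq x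
    simp only [ψ, map_zpow, FreeGroup.lift_apply_of] at hx
    rw [hg i n hx, zpow_zero]
  let F : CoprodI (fun _ : ι => FreeGroup Unit) →* PushoutI φ :=
    CoprodI.lift fun i => (PushoutI.of i).comp (ψ i)
  have hF : Function.Injective F := by
    rw [injective_iff_map_eq_one]
    intro x hx
    obtain ⟨w, rfl⟩ := CoprodI.Word.equiv.symm.surjective x
    let w' : CoprodI.Word G :=
      { toList := w.toList.map fun l => ⟨l.1, ψ l.1 l.2⟩
        ne_one := by
          intro l hl
          obtain ⟨l', hl', rfl⟩ := List.mem_map.1 hl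
          intro h
          exact w.ne_one l' hl' (hψ l'.1 l'.2 ((show ψ l'.1 l'.2 = 1 from h) ▸ one_mem _))
        chain_ne := by
          rw [List.isChain_map]
          exact w.chain_ne }
    have hw' : PushoutI.Reduced φ w' := by
      intro l hl
      obtain ⟨l', hl', rfl⟩ := List.mem_map.1 hl
      exact fun h => w.ne_one l' hl' (hψ _ _ h)
    have hprod : PushoutI.ofCoprodI (φ := φ) w'.prod = F w.prod := by
      simp only [CoprodI.Word.prod, w', map_list_prod, List.map_map]
      congr 2
    have he := hw'.eq_empty_of_mem_range hφ (by
      rw [hprod]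
      change F (CoprodI.Word.equiv.symm w) ∈ _
      rw [hx]; exact one_mem _)
    have : w = CoprodI.Word.empty := by
      ext1
      simpa [w', CoprodI.Word.empty] using congrArg CoprodI.Word.toList he
    rw [this]
    exact CoprodI.Word.prod_empty
  have : FreeGroup.lift (fun i => PushoutI.of (φ := φ) i (g i)) =
      F.comp (freeGroupEquivCoprodI (ι := ι)).toMonoidHom := by
    ext i
    simp [F, ψ, freeGroupEquivCoprodI]
  rw [this, MonoidHom.coe_comp]
  exact hF.comp (MulEquiv.injective _)

/-- A free group of rank two embeds in a group in which its generators are linked by an element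
`p` through two Baumslag–Solitar relations. -/
lemma exists_linking_group : ∃ (B : Type) (_ : Group B) (v p r : B),
    p * v = v * p ^ 2 ∧ r * p = p * r ^ 2 ∧
      Function.Injective (FreeGroup.lift fun i : Bool => cond i r v) := by
  let T : Equiv.Perm ℚ := Equiv.addRight 1
  let D : Equiv.Perm ℚ := Equiv.divRight₀ 2 two_ne_zero
  have hT : ∀ (n : ℤ) x, (T ^ n) x = x + n := by
    intro n x
    simp [T]
  have hD : ∀ (n : ℤ) x, (D ^ n) x = x / 2 ^ n := by
    intro n
    induction n using Int.induction_on with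
    | zero => simp
    | succ n ih =>
      intro x
      rw [zpow_add_one, Equiv.Perm.mul_apply, ih, zpow_add_one₀ two_ne_zero]
      simp [D]; ring
    | pred n ih =>
      intro x
      rw [zpow_sub_one, Equiv.Perm.mul_apply, ih, zpow_sub_one₀ two_ne_zero]
      have : D⁻¹ x = x * 2 := by
        rw [Equiv.Perm.inv_eq_iff_eq]; simp [D]
      rw [this]
      field_simp
  have hTD : T * D = D * T ^ 2 := by
    ext x
    simp [T, D, pow_two]
    ring
  have hTD' : ∀ n l : ℤ, T ^ n = D ^ l → n = 0 ∧ l = 0 := by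
    intro n l h
    have h0 := DFunLike.congr_fun h 0
    have h1 := DFunLike.congr_fun h 1
    rw [hT, hD] at h0 h1
    have hn : n = 0 := by simpa using h0
    refine ⟨hn, ?_⟩
    rw [hn] at h1
    have : (2 : ℚ) ^ l = 2 ^ (0 : ℤ) := by simpa using h1.symm
    exact zpow_right_injective₀ two_pos (by norm_num) this
  let φ : Bool → (Multiplicative ℤ →* Equiv.Perm ℚ) := fun i => zpowersHom _ (cond i D T)
  have hφ : ∀ i, Function.Injective (φ i) := by
    intro i
    rw [injective_iff_map_eq_one]
    intro n hn
    rw [← ofAdd_toAdd n]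
    cases i
    · exact congrArg Multiplicative.ofAdd
        (hTD' (Multiplicative.toAdd n) 0 (by simpa [φ] using hn)).1
    · exact congrArg Multiplicative.ofAdd
        (hTD' 0 (Multiplicative.toAdd n) (by simpa [φ] using hn.symm)).2
  let o : ∀ _ : Bool, Equiv.Perm ℚ →* PushoutI φ := fun i => PushoutI.of (φ := φ) i
  have hp : o true D = o false T := by
    have h1 := PushoutI.of_apply_eq_base φ true (Multiplicative.ofAdd 1)
    have h2 := PushoutI.of_apply_eq_base φ false (Multiplicative.ofAdd 1)
    simpa [φ] using h1.trans h2.symm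
  refine ⟨PushoutI φ, inferInstance, o false D, o false T, o true T, ?_, ?_, ?_⟩
  · rw [← map_mul, hTD, map_mul, map_pow]
  · rw [← hp, ← map_mul, hTD, map_mul, map_pow]
  · have := PushoutI.lift_of_injective hφ (fun i => cond i T D) (by
      rintro (_ | _) n ⟨l, hl⟩
      · exact (hTD' (Multiplicative.toAdd l) n (by simpa [φ] using hl)).2
      · exact (hTD' n (Multiplicative.toAdd l) (by simpa [φ] using hl.symm)).1)
    convert this using 3
    ext i
    cases i <;> rfl

/-- The two groups of a binary free product. -/
def PairType (A B : Type) : Bool → Type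
  | false => A
  | true => B

instance {A B : Type} [Group A] [Group B] : ∀ i, Group (PairType A B i)
  | false => inferInstanceAs (Group A)
  | true => inferInstanceAs (Group B)

lemma exists_free_factor {G : Type} [Group G] {u : G} (hu : ¬ IsOfFinOrder u) :
    ∃ (P : Type) (_ : Group P) (ι : G →* P) (y : P), Function.Injective ι ∧
      ∀ g, Function.Injective (FreeGroup.lift fun i : Bool => cond i (ι g * y) (ι u)) := by
  let φ : ∀ i, Unit →* PairType G (Multiplicative ℤ) i := fun _ => 1
  have hφ : ∀ i, Function.Injective (φ i) := fun i => Function.injective_of_subsingleton _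
  let P := PushoutI φ
  let ι : G →* P := PushoutI.of (φ := φ) false
  let η : Multiplicative ℤ →* P := PushoutI.of (φ := φ) true
  let y : P := η (Multiplicative.ofAdd 1)
  have h₀ : Function.Injective (FreeGroup.lift fun i : Bool => cond i y (ι u)) := by
    let g : ∀ i, PairType G (Multiplicative ℤ) i
      | false => u
      | true => Multiplicative.ofAdd (1 : ℤ)
    have := PushoutI.lift_of_injective hφ g (by
      rintro (_ | _) n ⟨l, hl⟩
      · by_contra hn
        exact hu (isOfFinOrder_iff_zpow_eq_one.2 ⟨n, hn, hl.symm⟩)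
      · have h : Multiplicative.ofAdd (n • (1 : ℤ)) = 1 := hl.symm
        simpa using h)
    convert this using 3
    ext i
    cases i <;> rfl
  let θ : G → (P →* P) := fun g => PushoutI.lift (fun i => match i with
    | false => ι
    | true => zpowersHom P (ι g * y)) 1 (by
      rintro (_ | _) <;> exact MonoidHom.ext fun _ => map_one _)
  have hθι : ∀ g h, θ g (ι h) = ι h := fun g h => PushoutI.lift_of ..
  have hθη : ∀ g n, θ g (η n) = zpowersHom P (ι g * y) n := fun g n => PushoutI.lift_of ..
  have hθy : ∀ g, θ g y = ι g * y := fun g => by simp [y, hθη]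
  have hθ : ∀ g, (θ g⁻¹).comp (θ g) = MonoidHom.id P := by
    intro g
    refine PushoutI.hom_ext_nonempty ?_
    rintro (_ | _)
    · exact MonoidHom.ext fun h => (congrArg (θ g⁻¹) (hθι g h)).trans (hθι g⁻¹ h)
    · refine MonoidHom.ext_mint ?_
      change θ g⁻¹ (θ g y) = y
      rw [hθy, map_mul, hθι, hθy, map_inv, mul_inv_cancel_left]
  refine ⟨P, inferInstance, ι, y, PushoutI.of_injective hφ _, fun g => ?_⟩
  have hinj : Function.Injective (θ g) :=
    Function.LeftInverse.injective (g := θ g⁻¹) fun x => DFunLike.congr_fun (hθ g) x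
  have : FreeGroup.lift (fun i : Bool => cond i (ι g * y) (ι u)) =
      (θ g).comp (FreeGroup.lift fun i : Bool => cond i y (ι u)) := by
    ext i
    cases i <;> simp [hθι, hθy]
  rw [this, MonoidHom.coe_comp]
  exact hinj.comp h₀

end FreeSubgroup

section Amalgam

open Cardinal

lemma exists_translation_equiv {F P V : Type} [Group F] [Group P] {α : F →* P}
    (hα : Function.Injective α) (hV : ℵ₀ ≤ #V) (hP : #P ≤ #V) :
    ∃ e : P × V ≃ F × V, ∀ f p v, e (p * α f, v) = ((e (p, v)).1 * f, (e (p, v)).2) := by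
  let T := P ⧸ α.range
  have hT : #T ≤ #V := (mk_le_of_surjective QuotientGroup.mk_surjective).trans hP
  obtain ⟨σ⟩ : Nonempty (T × V ≃ V) := by
    rw [← Cardinal.eq, mk_prod, lift_id, lift_id]
    exact mul_eq_right hV hT (mk_ne_zero T)
  have hex : ∀ p : P, ∃ f : F, α f = (p : T).out⁻¹ * p := fun p =>
    QuotientGroup.eq.1 (Quotient.out_eq (p : T))
  choose c hc using hex
  have hmk : ∀ p f, ((p * α f : P) : T) = p := fun p f =>
    (QuotientGroup.eq.2 (by simp)).symm
  have hcf : ∀ p f, c (p * α f) = c p * f := fun p f => hα <| by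
    rw [hc, hmk, map_mul, hc, mul_assoc]
  let e₀ : P ≃ T × F :=
    { toFun p := (p, c p)
      invFun x := x.1.out * α x.2
      left_inv p := by simp [hc]
      right_inv x := by
        have h : ((x.1.out * α x.2 : P) : T) = x.1 := by rw [hmk]; exact Quotient.out_eq _
        refine Prod.ext h (hα ?_)
        simp only
        rw [hc, h, inv_mul_cancel_left] }
  refine ⟨⟨fun x => (c x.1, σ (x.1, x.2)), fun y => (e₀.symm ((σ.symm y.2).1, y.1), (σ.symm y.2).2),
    ?_, ?_⟩, ?_⟩
  · rintro ⟨p, v⟩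
    have : e₀.symm ((p : T), c p) = p := e₀.symm_apply_apply p
    simp [this]
  · rintro ⟨f, v⟩
    have := e₀.apply_symm_apply ((σ.symm v).1, f)
    have h1 := congrArg Prod.fst this
    have h2 := congrArg Prod.snd this
    simp only [e₀, Equiv.coe_fn_mk] at h1 h2
    refine Prod.ext h2 ?_
    simp only [e₀]
    rw [h1, Prod.mk.eta, Equiv.apply_symm_apply]
  · intro f p v
    simp [hcf, hmk]

/-- A group embeds in a group in which every pair of elements freely generating a free group is
linked through two Baumslag–Solitar relations. -/
lemma exists_linked_overgroup (P : Type) [Group P] :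
    ∃ (M : Type) (_ : Group M) (ι : P →* M), Function.Injective ι ∧
      ∀ v r : P, Function.Injective (FreeGroup.lift fun i : Bool => cond i r v) →
        ∃ p : M, p * ι v = ι v * p ^ 2 ∧ ι r * p = p * ι r ^ 2 := by
  obtain ⟨B, _, v₀, p₀, r₀, h1, h2, hβ⟩ := exists_linking_group
  let V := ℕ × P × B
  have hV : ℵ₀ ≤ #V := Cardinal.infinite_iff.1 inferInstance
  have hP : #P ≤ #V := mk_le_of_surjective (f := fun x : V => x.2.1) fun p => ⟨(0, p, 1), rfl⟩
  have hB : #B ≤ #V := mk_le_of_surjective (f := fun x : V => x.2.2) fun b => ⟨(0, 1, b), rfl⟩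
  let reg : ∀ (Q : Type) [Group Q], Q →* Equiv.Perm (Q × V) := fun Q _ =>
    { toFun q := (Equiv.mulRight q⁻¹).prodCongr (Equiv.refl V)
      map_one' := by ext x <;> simp
      map_mul' g h := by ext x <;> simp [mul_assoc] }
  have hreg : ∀ (Q : Type) [Group Q] (q x : Q) v, reg Q q (x, v) = (x * q⁻¹, v) :=
    fun Q _ q x v => rfl
  refine ⟨Equiv.Perm (P × V), inferInstance, reg P, ?_, fun v r hα => ?_⟩
  · intro p q hpq
    have := DFunLike.congr_fun hpq (1, (0, 1, 1))
    rw [hreg, hreg] at this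
    simpa using this
  · set α := FreeGroup.lift fun i : Bool => cond i r v with hαdef
    set β := FreeGroup.lift fun i : Bool => cond i r₀ v₀ with hβdef
    obtain ⟨e, he⟩ := exists_translation_equiv hα hV hP
    obtain ⟨e', he'⟩ := exists_translation_equiv hβ hV hB
    let θ : P × V ≃ B × V := e.trans e'.symm
    let ρ : B →* Equiv.Perm (P × V) := θ.symm.permCongrHom.toMonoidHom.comp (reg B)
    have hρ : ∀ f, ρ (β f) = reg P (α f) := by
      intro f
      have key : ∀ p v, θ (p * α f, v) = ((θ (p, v)).1 * β f, (θ (p, v)).2) := by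
        intro p v
        have hθ : e' (θ (p, v)) = e (p, v) := by simp [θ]
        rw [show θ (p * α f, v) = e'.symm (e (p * α f, v)) from rfl, Equiv.symm_apply_eq, he, he']
        rw [Prod.mk.eta, hθ]
      ext1 ⟨p, v⟩
      change θ.symm (reg B (β f) (θ (p, v))) = _
      rw [Equiv.symm_apply_eq, hreg]
      have := key (p * (α f)⁻¹) v
      rw [inv_mul_cancel_right] at this
      rw [this, hreg, mul_inv_cancel_right]
    have hv : ρ v₀ = reg P v := by simpa [hαdef, hβdef] using hρ (FreeGroup.of false)
    have hr : ρ r₀ = reg P r := by simpa [hαdef, hβdef] using hρ (FreeGroup.of true)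
    refine ⟨ρ p₀, ?_, ?_⟩
    · rw [← hv, ← map_mul, h1, map_mul, map_pow]
    · rw [← hr, ← map_mul, h2, map_mul, map_pow]

end Amalgam

lemma exists_equiv_over {Y Z C : Type} {f : Y → C} {g : Z → C}
    (h : ∀ c, Nonempty ({y // f y = c} ≃ {z // g z = c})) {y₀ : Y} {z₀ : Z} (h₀ : f y₀ = g z₀) :
    ∃ σ : Y ≃ Z, (∀ y, g (σ y) = f y) ∧ σ y₀ = z₀ := by
  classical
  let τ : Y ≃ Z := Equiv.ofFiberEquiv fun c => (h c).some
  have hτ : ∀ y, g (τ y) = f y := Equiv.ofFiberEquiv_map _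
  refine ⟨τ.trans (Equiv.swap (τ y₀) z₀), fun y => ?_, by simp⟩
  rw [← hτ, Equiv.trans_apply, Equiv.swap_apply_def]
  split_ifs with h1 h2
  · rw [h1, hτ, h₀]
  · rw [h2, hτ, h₀]
  · rfl

namespace ColoredLattice

open Cardinal

variable {D : Type}

/-- A type of labels of sufficiently large cardinality. -/
abbrev Label (D : Type) : Type := ℕ × (D → ℤ) × Set (D → ℤ)

/-- Points of the lattice, together with a coloring and a label. -/
abbrev Pt (D : Type) : Type := (D → ℤ) × Set (D → ℤ) × Label D

open Classical in
/-- Erase the coordinates that are annihilated by the multiplier. -/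
noncomputable def trunc (m k : D → ℤ) : D → ℤ := fun i => if m i = 0 then 0 else k i

lemma mul_trunc (m k : D → ℤ) : m * trunc m k = m * k := by
  ext i
  by_cases h : m i = 0 <;> simp [trunc, h]

lemma trunc_div (m w : D → ℤ) : trunc m (w / m) = w / m := by
  ext i
  by_cases h : m i = 0 <;> simp [trunc, h]

lemma trunc_neg (m w : D → ℤ) : trunc m (-w) = -trunc m w := by
  ext i
  by_cases h : m i = 0 <;> simp [trunc, h]

lemma add_mul_div (m w k : D → ℤ) : (w + m * k) / m = w / m + trunc m k := by
  ext i
  by_cases h : m i = 0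
  · simp [trunc, h]
  · simp [trunc, h, Int.add_mul_ediv_left]

/-- Truncated vectors. -/
abbrev Trunc (τ : (D → ℤ) → (D → ℤ)) : Type := {h : D → ℤ // τ h = h}

/-- Representatives of the orbits under translation by multiples, with colorings and labels. -/
abbrev Orbits (m : D → ℤ) : Type := {r : D → ℤ // r / m = 0} × Set (D → ℤ) × Label D

/-- The colors met along an orbit. -/
def pattern (τ : (D → ℤ) → (D → ℤ)) (c m : D → ℤ) (y : Orbits m) (h : Trunc τ) : Prop :=
  c + y.1.1 + m * h.1 ∈ y.2.1

lemma mk_pattern_fiber {τ : (D → ℤ) → (D → ℤ)} {m : D → ℤ} (hτ : trunc m = τ) (c : D → ℤ)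
    (π : Trunc τ → Prop) : #{y : Orbits m // pattern τ c m y = π} = #(Label D) := by
  apply le_antisymm
  · have hV : ℵ₀ ≤ #(Label D) := Cardinal.infinite_iff.1 inferInstance
    have h1 : #((D → ℤ) × Set (D → ℤ)) ≤ #(Label D) :=
      mk_le_of_surjective (f := fun x : Label D => x.2) fun p => ⟨(0, p), rfl⟩
    have h2 : #(((D → ℤ) × Set (D → ℤ)) × Label D) = #(Label D) := by
      rw [mk_prod, lift_id, lift_id]
      exact mul_eq_right hV h1 (mk_ne_zero _)
    rw [← h2]
    refine mk_le_of_injective (f := fun y => ((y.1.1.1, y.1.2.1), y.1.2.2)) ?_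
    rintro ⟨⟨⟨r, hr⟩, f, v⟩, h⟩ ⟨⟨⟨r', hr'⟩, f', v'⟩, h'⟩ he
    simp only [Prod.mk.injEq] at he
    obtain ⟨⟨rfl, rfl⟩, rfl⟩ := he
    rfl
  · have hpat : ∀ v, pattern τ c m (⟨0, by ext; simp⟩, {w | ∃ h, π h ∧ w = c + m * h.1}, v) =
      π := by
      intro v
      ext h
      simp only [pattern, Set.mem_ofPred_eq, add_zero]
      constructor
      · rintro ⟨h', hh', he⟩
        have he' : h = h' := by
          have := congrArg (· / m) (add_left_cancel he)
          have h0 : ∀ k, (m * k) / m = trunc m k := fun k => by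
            have h00 : (0 : D → ℤ) / m = 0 := by ext; simp
            simpa [h00] using add_mul_div m 0 k
          simp only [h0, hτ, h.2, h'.2] at this
          exact Subtype.ext this
        rwa [he']
      · exact fun hh => ⟨h, hh, rfl⟩
    refine mk_le_of_injective (f := fun v => ⟨_, hpat v⟩) ?_
    intro v v' h
    simpa using h

/-- The decomposition of the lattice into orbits. -/
noncomputable def orbitEquiv {τ : (D → ℤ) → (D → ℤ)} (c m : D → ℤ) (hτ : trunc m = τ) :
    Pt D ≃ Orbits m × Trunc τ where
  toFun x := ((⟨x.1 - c - m * ((x.1 - c) / m), by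
    rw [sub_eq_add_neg, ← mul_neg, add_mul_div, trunc_neg, trunc_div, add_neg_cancel]⟩, x.2),
      ⟨(x.1 - c) / m, by rw [← hτ, trunc_div]⟩)
  invFun y := (c + y.1.1.1 + m * y.2.1, y.1.2)
  left_inv x := by
    refine Prod.ext ?_ rfl
    simp only
    ring
  right_inv := by
    rintro ⟨⟨⟨r, hr⟩, x⟩, ⟨h, hh⟩⟩
    have e : (c + r + m * h - c) / m = h := by
      rw [show c + r + m * h - c = r + m * h by ring, add_mul_div, hr, hτ, hh, zero_add]
    refine Prod.ext (Prod.ext (Subtype.ext ?_) rfl) (Subtype.ext e)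
    simp only
    rw [e]
    ring

lemma exists_step {a b m m' : D → ℤ} (hm : ∀ i, m i = 0 ↔ m' i = 0) {S : Set (D → ℤ)}
    (hS : ∀ h, a + m * h ∈ S ↔ b + m' * h ∈ S) (v₀ : Label D) :
    ∃ s : Equiv.Perm (Pt D), (∀ w x k, s (w + m' * k, x) = ((s (w, x)).1 + m * k, (s (w, x)).2)) ∧
      (∀ x, (s x).1 ∈ (s x).2.1 ↔ x.1 ∈ x.2.1) ∧ s (b, S, v₀) = (a, S, v₀) := by
  have hτ' : trunc m' = trunc m := by
    ext k i
    simp [trunc, hm]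
  have h0 : ∀ m : D → ℤ, 0 / m = 0 := fun m => by ext; simp
  obtain ⟨σ, hσ, hσ₀⟩ := exists_equiv_over (f := pattern (trunc m) b m')
    (g := pattern (trunc m) a m)
    (fun π => Cardinal.eq.1 ((mk_pattern_fiber hτ' b π).trans (mk_pattern_fiber rfl a π).symm))
    (y₀ := (⟨0, h0 m'⟩, S, v₀)) (z₀ := (⟨0, h0 m⟩, S, v₀)) (by
      ext h
      simp [pattern, hS])
  let E' := orbitEquiv b m' hτ'
  let E := orbitEquiv a m rfl
  refine ⟨E'.trans ((σ.prodCongr (Equiv.refl _)).trans E.symm), ?_, ?_, ?_⟩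
  · intro w x k
    have h1 : (E' (w + m' * k, x)).1 = (E' (w, x)).1 := by
      refine Prod.ext (Subtype.ext ?_) rfl
      simp only [E', orbitEquiv, Equiv.coe_fn_mk]
      rw [show w + m' * k - b = w - b + m' * k by ring, add_mul_div, mul_add, mul_trunc]
      ring
    have h2 : (E' (w + m' * k, x)).2.1 = (E' (w, x)).2.1 + trunc m k := by
      simp only [E', orbitEquiv, Equiv.coe_fn_mk]
      rw [show w + m' * k - b = w - b + m' * k by ring, add_mul_div, hτ']
    change (a + (σ (E' (w + m' * k, x)).1).1.1 + m * (E' (w + m' * k, x)).2.1,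
      (σ (E' (w + m' * k, x)).1).2) =
        (a + (σ (E' (w, x)).1).1.1 + m * (E' (w, x)).2.1 + m * k, (σ (E' (w, x)).1).2)
    rw [h2, h1, mul_add, mul_trunc, ← add_assoc]
  · intro x
    obtain ⟨⟨y, h⟩, rfl⟩ := E'.symm.surjective x
    have := congrFun (hσ y) h
    simp only [Equiv.trans_apply, Equiv.apply_symm_apply]
    exact iff_of_eq this
  · have : (b, S, v₀) = E'.symm ((⟨0, h0 m'⟩, S, v₀), ⟨0, by ext; simp [trunc]⟩) := by
      refine Prod.ext ?_ rfl
      simp [E', orbitEquiv]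
    rw [this]
    simp only [Equiv.trans_apply, Equiv.apply_symm_apply, Equiv.prodCongr_apply, Prod.map, hσ₀]
    refine Prod.ext ?_ rfl
    simp [E, orbitEquiv]

end ColoredLattice

section Detector

variable {Y : Type}

/-- Lift a permutation to the product with the integers. -/
def liftPerm (Y : Type) : Equiv.Perm Y →* Equiv.Perm (Y × ℤ) where
  toFun σ := σ.prodCongr (Equiv.refl ℤ)
  map_one' := by ext x <;> simp
  map_mul' σ τ := by ext x <;> simp

open Classical in
/-- Shift the integer coordinate over the points satisfying a predicate. -/
noncomputable def shiftOver (P : Y → Prop) : Equiv.Perm (Y × ℤ) where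
  toFun x := (x.1, x.2 + if P x.1 then 1 else 0)
  invFun x := (x.1, x.2 - if P x.1 then 1 else 0)
  left_inv x := by simp
  right_inv x := by simp

open Classical in
lemma shiftOver_commute {P : Y → Prop} {σ : Equiv.Perm Y} (h : ∀ y, P (σ y) ↔ P y) :
    shiftOver P * liftPerm Y σ = liftPerm Y σ * shiftOver P := by
  ext1 x
  simpa [shiftOver, liftPerm] using if_congr (h x.1) rfl rfl

lemma shiftOver_apply_of {P : Y → Prop} {y : Y} (h : P y) (z : ℤ) :
    shiftOver P (y, z) = (y, z + 1) := by
  simp [shiftOver, h]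

lemma shiftOver_apply_of_not {P : Y → Prop} {y : Y} (h : ¬ P y) (z : ℤ) :
    shiftOver P (y, z) = (y, z) := by
  simp [shiftOver, h]

lemma shiftOver_commutator_infinite {P : Y → Prop} {σ : Equiv.Perm Y} {y : Y} (hy : P y)
    (hσ : ¬ P (σ y)) :
    ¬ IsOfFinOrder ((shiftOver P)⁻¹ * (liftPerm Y σ)⁻¹ * shiftOver P * liftPerm Y σ) := by
  have h1 : ∀ z, ((shiftOver P)⁻¹ * (liftPerm Y σ)⁻¹ * shiftOver P * liftPerm Y σ) (y, z) =
      (y, z - 1) := by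
    intro z
    simp only [Equiv.Perm.mul_apply]
    rw [Equiv.Perm.inv_eq_iff_eq, Equiv.Perm.inv_eq_iff_eq, shiftOver_apply_of hy,
      show liftPerm Y σ (y, z) = (σ y, z) from rfl, shiftOver_apply_of_not hσ]
    simp [liftPerm]
  have h2 : ∀ (l : ℕ) z, (((shiftOver P)⁻¹ * (liftPerm Y σ)⁻¹ * shiftOver P * liftPerm Y σ) ^ l)
      (y, z) = (y, z - l) := by
    intro l
    induction l with
    | zero => simp
    | succ l ih =>
      intro z
      rw [pow_succ, Equiv.Perm.mul_apply, h1, ih]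
      push_cast
      ring_nf
  intro h
  obtain ⟨l, hl, he⟩ := isOfFinOrder_iff_pow_eq_one.1 h
  have := h2 l 0
  rw [he] at this
  simp at this
  omega

end Detector

section BaseModel

variable {J D : Type} [Fintype D] [DecidableEq D]

open ColoredLattice

/-- Translations of the lattice. -/
def translation (D : Type) : Multiplicative (D → ℤ) →* Equiv.Perm (Pt D × Bool) where
  toFun v := ((Equiv.subRight v.toAdd).prodCongr (Equiv.refl _)).prodCongr (Equiv.refl _)
  map_one' := by ext x <;> simp
  map_mul' v w := by ext x <;> simp; ring

lemma monomial_ofAdd_single (v : D → ℤ) :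
    monomial (fun i : D => Multiplicative.ofAdd (Pi.single i (1 : ℤ) : D → ℤ)) v =
      Multiplicative.ofAdd v := by
  rw [monomial, Finset.prod_map_toList]
  apply Multiplicative.toAdd.injective
  rw [toAdd_prod]
  ext l
  simp [Finset.sum_apply, Pi.single_apply]

lemma exists_baseRel {a b m m' : J → D → ℤ} {w : D → ℤ} (hm : ∀ j i, m j i = 0 ↔ m' j i = 0)
    {v : D → ℤ} (hv : ¬ Relation.EqvGen (AffineStep a b m m') v w) :
    ∃ (G : Type) (_ : Group G) (f : BaseGen J D → G), BaseRel a b m m' w f ∧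
      ¬ IsOfFinOrder ((f .k)⁻¹ * (pointer f v)⁻¹ * f .k * pointer f v) := by
  have : DecidableEq (Pt D × Bool) := Classical.decEq _
  let S : Set (D → ℤ) := {v | Relation.EqvGen (AffineStep a b m m') v w}
  have hS : ∀ j h, a j + m j * h ∈ S ↔ b j + m' j * h ∈ S := fun j h =>
    ⟨fun H => .trans _ _ _ (.symm _ _ (.rel _ _ ⟨j, h, rfl, rfl⟩)) H,
      fun H => .trans _ _ _ (.rel _ _ ⟨j, h, rfl, rfl⟩) H⟩
  have hw : w ∈ S := .refl _
  let v₀ : Label D := (0, 0, ∅)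
  choose s hs hsc hs₀ using fun j => exists_step (hm j) (hS j) v₀
  let pt : (D → ℤ) → Bool → Pt D × Bool := fun v ε => ((v, S, v₀), ε)
  let g : BaseGen J D → Equiv.Perm (Pt D × Bool)
    | .x i => translation D (Multiplicative.ofAdd (Pi.single i 1))
    | .s j => (s j).prodCongr (Equiv.refl _)
    | .t => Equiv.swap (pt 0 false) (pt 0 true)
    | .k => 1
  have hg : ∀ v, pointer g v = Equiv.swap (pt v false) (pt v true) := by
    intro v
    have h1 : monomial (fun i => g (.x i)) v = translation D (Multiplicative.ofAdd v) := by
      rw [← monomial_ofAdd_single v, map_monomial]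
    have h2 : ∀ ε, (translation D (Multiplicative.ofAdd v))⁻¹ (pt 0 ε) = pt v ε := by
      intro ε
      rw [Equiv.Perm.inv_eq_iff_eq]
      simp [translation, pt]
    rw [pointer, h1, Equiv.mul_swap_eq_swap_mul, h2, h2, inv_mul_cancel_right]
  let P : Pt D × Bool → Prop := fun y => y.2 = false ∨ y.1.1 ∈ y.1.2.1
  let f : BaseGen J D → Equiv.Perm ((Pt D × Bool) × ℤ)
    | .k => shiftOver P
    | r => liftPerm _ (g r)
  have hf : ∀ v, pointer f v = liftPerm _ (Equiv.swap (pt v false) (pt v true)) := by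
    intro v
    rw [← hg, map_pointer]
    rfl
  refine ⟨_, inferInstance, f, ⟨?_, ?_, ?_, ?_, ?_⟩, ?_⟩
  · intro i l
    simp only [f, g, ← map_mul, mul_comm]
  · intro j i
    simp only [f, ← map_mul, ← map_zpow]
    congr 1
    ext1 ⟨⟨z, x⟩, ε⟩
    simp only [g, ← map_zpow, ← ofAdd_zsmul]
    have key := hs j z x (-Pi.single i 1)
    have e : ∀ m : D → ℤ, m * -Pi.single i 1 = -(m i • Pi.single i 1) := by
      intro m
      ext l
      by_cases h : l = i
      · subst h; simp
      · simp [h]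
    rw [e, e, ← sub_eq_add_neg, ← sub_eq_add_neg] at key
    change (((s j (z, x)).1 - m j i • Pi.single i 1, (s j (z, x)).2), ε) =
      (s j (z - m' j i • Pi.single i 1, x), ε)
    rw [key]
  · intro j
    rw [hf, hf]
    simp only [f, ← map_mul]
    congr 1
    have h2 : ∀ ε, g (.s j) (pt (b j) ε) = pt (a j) ε := fun ε => Prod.ext (hs₀ j) rfl
    rw [Equiv.mul_swap_eq_swap_mul, h2, h2]
  · rw [hf]
    refine shiftOver_commute fun y => ?_
    rw [Equiv.swap_apply_def]
    split_ifs with h1 h2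
    · subst h1; simp [P, pt, hw]
    · subst h2; simp [P, pt, hw]
    · rfl
  · exact fun j => shiftOver_commute fun y => or_congr Iff.rfl (hsc j y.1)
  · rw [hf]
    refine shiftOver_commutator_infinite (P := P) (y := pt v false) (Or.inl rfl) ?_
    rw [Equiv.swap_apply_left]
    have hv' : v ∉ S := hv
    simpa [P, pt] using hv'

/-- The perfect group has a nontrivial quotient when the two vectors are not related. -/
theorem exists_genRel {a b m m' : J → D → ℤ} {w : D → ℤ} (hm : ∀ j i, m j i = 0 ↔ m' j i = 0)
    {e : D} {n : ℕ} (hn : ¬ Relation.EqvGen (AffineStep a b m m') (Pi.single e (n : ℤ)) w) :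
    ∃ (M : Type) (_ : Group M) (f : Gen J D → M), GenRel a b m m' w f ∧
      f .e = f (.base (.x e)) ^ n ∧ ¬ IsOfFinOrder (f .u) := by
  obtain ⟨G, _, f, hf, hu⟩ := exists_baseRel hm hn
  rw [pointer, monomial_single, zpow_natCast] at hu
  set ε := f (.x e) ^ n with hε
  set u := (f .k)⁻¹ * (ε⁻¹ * f .t * ε)⁻¹ * f .k * (ε⁻¹ * f .t * ε) with hudef
  obtain ⟨P, _, ι, y, hι, hfree⟩ := exists_free_factor hu
  obtain ⟨M, _, κ, hκ, hlink⟩ := exists_linked_overgroup P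
  let tw : Option (BaseGen J D) → P := fun o => o.elim y fun g => ι (f g) * y
  have htw : ∀ o, ∃ p : M, p * κ (ι u) = κ (ι u) * p ^ 2 ∧ κ (tw o) * p = p * κ (tw o) ^ 2 := by
    rintro (_ | g)
    · exact hlink _ _ (by simpa [tw] using hfree 1)
    · exact hlink _ _ (hfree (f g))
  choose p hp₁ hp₂ using htw
  obtain ⟨q, hq₁, hq₂⟩ := hlink y (ι u) (by
    have h := hfree 1
    simp only [map_one, one_mul] at h
    have e : FreeGroup.lift (fun i : Bool => cond i (ι u) y) =
        (FreeGroup.lift fun i : Bool => cond i y (ι u)).comp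
          (FreeGroup.freeGroupCongr (Equiv.boolNot)).toMonoidHom := by
      ext i
      cases i <;> simp
    rw [e, MonoidHom.coe_comp]
    exact h.comp (MulEquiv.injective _))
  let F : Gen J D → M
    | .base g => κ (ι (f g))
    | .y => κ y
    | .u => κ (ι u)
    | .e => κ (ι ε)
    | .q => q
    | .p o => p o
  have hF : ∀ o, twisted F o = κ (tw o) := by
    rintro (_ | g)
    · rfl
    · exact (map_mul κ _ _).symm
  refine ⟨M, inferInstance, F, ⟨?_, ?_, hp₁, ?_, hq₁, hq₂⟩, ?_, ?_⟩
  · exact hf.map (κ.comp ι)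
  · simp [F, hudef]
  · intro o
    rw [hF]
    exact hp₂ o
  · simp [F, hε]
  · change ¬ IsOfFinOrder (κ (ι u))
    rwa [hκ.isOfFinOrder_iff, hι.isOfFinOrder_iff]

end BaseModel

section Relators

variable {J D : Type} [Finite J] [Fintype D]

lemma BaseRel.exists_relators (a b m m' : J → D → ℤ) (w : D → ℤ) :
    ∃ R : Set (FreeGroup (BaseGen J D)), R.Finite ∧ ∀ {H : Type} [Group H] (f : BaseGen J D → H),
      (∀ r ∈ R, FreeGroup.lift f r = 1) ↔ BaseRel a b m m' w f := by
  let o : BaseGen J D → FreeGroup (BaseGen J D) := FreeGroup.of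
  refine ⟨Set.range (fun z : D × D => o (.x z.1) * o (.x z.2) * (o (.x z.2) * o (.x z.1))⁻¹) ∪
    Set.range (fun z : J × D => o (.x z.2) ^ m z.1 z.2 * o (.s z.1) *
      (o (.s z.1) * o (.x z.2) ^ m' z.1 z.2)⁻¹) ∪
    Set.range (fun j => pointer o (a j) * o (.s j) * (o (.s j) * pointer o (b j))⁻¹) ∪
    {o .k * pointer o w * (pointer o w * o .k)⁻¹} ∪
    Set.range (fun j => o .k * o (.s j) * (o (.s j) * o .k)⁻¹), ?_, ?_⟩
  · exact ((((Set.finite_range _).union (Set.finite_range _)).union (Set.finite_range _)).union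
      (Set.finite_singleton _)).union (Set.finite_range _)
  · intro H _ f
    simp only [Set.mem_union, or_imp, forall_and, Set.forall_mem_range, Set.mem_singleton_iff,
      forall_eq, Prod.forall, map_mul, map_inv, map_zpow, map_pointer, o, FreeGroup.lift_apply_of,
      mul_inv_eq_one]
    exact ⟨fun h => ⟨h.1.1.1.1, h.1.1.1.2, h.1.1.2, h.1.2, h.2⟩,
      fun h => ⟨⟨⟨⟨h.x_x, h.x_s⟩, h.t_s⟩, h.k_t⟩, h.k_s⟩⟩

lemma GenRel.exists_relators (a b m m' : J → D → ℤ) (w : D → ℤ) :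
    ∃ R : Set (FreeGroup (Gen J D)), R.Finite ∧ ∀ {H : Type} [Group H] (f : Gen J D → H),
      (∀ r ∈ R, FreeGroup.lift f r = 1) ↔ GenRel a b m m' w f := by
  obtain ⟨R, hR, hR'⟩ := BaseRel.exists_relators a b m m' w
  let o : Gen J D → FreeGroup (Gen J D) := FreeGroup.of
  refine ⟨FreeGroup.map Gen.base '' R ∪
    {o .u * ((o (.base .k))⁻¹ * ((o .e)⁻¹ * o (.base .t) * o .e)⁻¹ *
      o (.base .k) * ((o .e)⁻¹ * o (.base .t) * o .e))⁻¹} ∪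
    Set.range (fun g => o (.p g) * o .u * (o .u * o (.p g) ^ 2)⁻¹) ∪
    Set.range (fun g => twisted o g * o (.p g) * (o (.p g) * twisted o g ^ 2)⁻¹) ∪
    {o .q * o .y * (o .y * o .q ^ 2)⁻¹} ∪ {o .u * o .q * (o .q * o .u ^ 2)⁻¹}, ?_, ?_⟩
  · exact (((((hR.image _).union (Set.finite_singleton _)).union (Set.finite_range _)).union
      (Set.finite_range _)).union (Set.finite_singleton _)).union (Set.finite_singleton _)
  · intro H _ f
    have e : ∀ r, FreeGroup.lift f (FreeGroup.map Gen.base r) =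
        FreeGroup.lift (fun g => f (.base g)) r := fun r =>
      DFunLike.congr_fun (show (FreeGroup.lift f).comp (FreeGroup.map Gen.base) =
        FreeGroup.lift (fun g => f (.base g)) by ext; simp) r
    simp only [Set.mem_union, or_imp, forall_and, Set.forall_mem_range, Set.mem_singleton_iff,
      forall_eq, Set.forall_mem_image, e, hR']
    simp only [map_mul, map_inv, map_pow, map_twisted, o, FreeGroup.lift_apply_of, mul_inv_eq_one]
    exact ⟨fun h => ⟨h.1.1.1.1.1, h.1.1.1.1.2, h.1.1.1.2, h.1.1.2, h.1.2, h.2⟩,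
      fun h => ⟨⟨⟨⟨⟨h.base, h.u_eq⟩, h.p_u⟩, h.y_p⟩, h.q_y⟩, h.u_q⟩⟩

/-- Two copies of the relations of the perfect group, sharing the element `u`. -/
structure DoubleRel (a b m m' : J → D → ℤ) (w : D → ℤ) {H : Type*} [Group H]
    (f : Bool → Gen J D → H) : Prop where
  gen : ∀ i, GenRel a b m m' w (f i)
  u_eq : f false .u = f true .u

lemma DoubleRel.exists_relators {X : Type} (ν : Bool → Gen J D → X) (a b m m' : J → D → ℤ)
    (w : D → ℤ) :
    ∃ R : Set (FreeGroup X), R.Finite ∧ ∀ {H : Type} [Group H] (f : X → H),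
      (∀ r ∈ R, FreeGroup.lift f r = 1) ↔ DoubleRel a b m m' w fun i g => f (ν i g) := by
  obtain ⟨R, hR, hR'⟩ := GenRel.exists_relators a b m m' w
  refine ⟨(⋃ i, FreeGroup.map (ν i) '' R) ∪
    {FreeGroup.of (ν false .u) * (FreeGroup.of (ν true .u))⁻¹},
    (Set.finite_iUnion fun i => hR.image _).union (Set.finite_singleton _), ?_⟩
  intro H _ f
  have e : ∀ i r, FreeGroup.lift f (FreeGroup.map (ν i) r) =
      FreeGroup.lift (fun g => f (ν i g)) r := fun i r =>
    DFunLike.congr_fun (show (FreeGroup.lift f).comp (FreeGroup.map (ν i)) =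
      FreeGroup.lift (fun g => f (ν i g)) by ext; simp) r
  have e' : (∀ r ∈ ⋃ i, FreeGroup.map (ν i) '' R, FreeGroup.lift f r = 1) ↔
      ∀ i, GenRel a b m m' w fun g => f (ν i g) := by
    simp only [Set.mem_iUnion, ← hR', ← e]
    exact ⟨fun h i r hr => h _ ⟨i, r, hr, rfl⟩, by rintro h _ ⟨i, r, hr, rfl⟩; exact h i r hr⟩
  simp only [Set.mem_union, or_imp, forall_and, Set.mem_singleton_iff, forall_eq, e',
    map_mul, map_inv, FreeGroup.lift_apply_of, mul_inv_eq_one]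
  exact ⟨fun h => ⟨h.1, h.2⟩, fun h => ⟨h.1, h.2⟩⟩

end Relators

section Words

variable {k : ℕ}

/-- A nonreduced word representing `x ^ n * e⁻¹`. -/
def powWord (x e : Fin k) (n : ℕ) : List (Fin k × Bool) :=
  (x, true) :: (x, false) :: ((fun l => (x, true) :: l)^[n] [(e, false)])

lemma computable_powWord (x e : Fin k) : Computable (powWord x e) := by
  have h : Primrec fun n : ℕ => (fun l => (x, true) :: l)^[n] [(e, false)] :=
    Primrec.nat_iterate .id (.const _)
      (Primrec.list_cons.comp (.const _) Primrec.snd).to₂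
  exact (Primrec.list_cons.comp (.const _) (Primrec.list_cons.comp (.const _) h)).to_comp

lemma lift_mk_powWord {H : Type*} [Group H] (f : Fin k → H) (x e : Fin k) (n : ℕ) :
    FreeGroup.lift f (FreeGroup.mk (powWord x e n)) = f x ^ n * (f e)⁻¹ := by
  have h : ∀ n, FreeGroup.lift f (FreeGroup.mk ((fun l => (x, true) :: l)^[n] [(e, false)])) =
      f x ^ n * (f e)⁻¹ := by
    intro n
    induction n with
    | zero => simp
    | succ n ih =>
      rw [Function.iterate_succ_apply']
      simp only [FreeGroup.lift_mk, List.map_cons, List.prod_cons, cond_true] at ih ⊢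
      rw [ih, pow_succ', mul_assoc]
  have := h n
  simp only [FreeGroup.lift_mk] at this
  simp [powWord, this]

lemma mem_powWord (x e : Fin k) (n : ℕ) : (e, false) ∈ powWord x e n := by
  have h : ∀ n, (e, false) ∈ (fun l => (x, true) :: l)^[n] [(e, false)] := by
    intro n
    induction n with
    | zero => simp
    | succ n ih =>
      rw [Function.iterate_succ_apply']
      exact List.mem_cons_of_mem _ ih
  simp [powWord, h]

/-- Finitely many relators, together with two relators depending on a parameter, can be encoded by
a computable sequence of sets of words of constant large cardinality. -/
lemma exists_computable_words {R : Set (FreeGroup (Fin k))} (hR : R.Finite) {x e x' e' : Fin k}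
    (hex : e ≠ x) (hex' : e' ≠ x) (hxx' : x ≠ x') :
    ∃ (c : ℕ) (Sig : ℕ → List (List (Fin k × Bool))), Computable Sig ∧ c > k ∧
      (∀ n, (Sig n).toFinset.card = c) ∧ ∀ n {H : Type} [Group H] (f : Fin k → H),
        (∀ r ∈ FreeGroup.mk '' {w | w ∈ Sig n}, FreeGroup.lift f r = 1) ↔
          (∀ r ∈ R, FreeGroup.lift f r = 1) ∧ f e = f x ^ n ∧ f e' = f x' ^ n := by
  let pad : ℕ → List (Fin k × Bool) := fun i =>
    List.replicate i (x, true) ++ List.replicate i (x, false)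
  have hpad : ∀ {H : Type} [Group H] (f : Fin k → H) i,
      FreeGroup.lift f (FreeGroup.mk (pad i)) = 1 := by
    intro H _ f i
    simp [pad, FreeGroup.lift_mk]
  have hpad_inj : Function.Injective pad := by
    intro i j hij
    have := congrArg List.length hij
    simp only [pad, List.length_append, List.length_replicate] at this
    omega
  have hpad_mem : ∀ {i g s}, (g, s) ∈ pad i → g = x := by
    intro i g s h
    simp only [pad, List.mem_append, List.mem_replicate, Prod.mk.injEq] at h
    tauto
  let W : Finset (List (Fin k × Bool)) :=
    hR.toFinset.image FreeGroup.toWord ∪ (Finset.range (k + 1)).image pad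
  have hW : ∀ {y g : Fin k} n, g ≠ x → powWord y g n ∉ W := by
    intro y g n hg h
    rcases Finset.mem_union.1 h with h | h
    · obtain ⟨r, -, hr⟩ := Finset.mem_image.1 h
      have := hr ▸ FreeGroup.isReduced_toWord (x := r)
      rw [powWord, FreeGroup.isReduced_cons_cons] at this
      simpa using this.1
    · obtain ⟨i, -, hi⟩ := Finset.mem_image.1 h
      exact hg (hpad_mem (hi ▸ mem_powWord y g n))
  have hne : ∀ n, powWord x e n ≠ powWord x' e' n := by
    intro n h
    simp only [powWord, List.cons.injEq, Prod.mk.injEq] at h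
    exact hxx' h.1.1
  refine ⟨W.card + 2, fun n => powWord x e n :: powWord x' e' n :: W.toList, ?_, ?_, ?_, ?_⟩
  · exact Computable.list_cons.comp (computable_powWord x e)
      (Computable.list_cons.comp (computable_powWord x' e') (.const _))
  · have : ((Finset.range (k + 1)).image pad).card ≤ W.card :=
      Finset.card_le_card Finset.subset_union_right
    rw [Finset.card_image_of_injective _ hpad_inj, Finset.card_range] at this
    omega
  · intro n
    rw [List.toFinset_cons, List.toFinset_cons, Finset.toList_toFinset,
      Finset.card_insert_of_notMem, Finset.card_insert_of_notMem (hW n hex')]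
    rw [Finset.mem_insert, not_or]
    exact ⟨hne n, hW n hex⟩
  · intro n H _ f
    have key : (∀ l ∈ W, FreeGroup.lift f (FreeGroup.mk l) = 1) ↔
        ∀ r ∈ R, FreeGroup.lift f r = 1 := by
      simp only [W, Finset.mem_union, or_imp, forall_and, Finset.forall_mem_image, hpad,
        FreeGroup.mk_toWord, Set.Finite.mem_toFinset, implies_true, and_true]
    simp only [Set.forall_mem_image, Set.mem_ofPred_eq, List.forall_mem_cons, Finset.mem_toList,
      key, lift_mk_powWord, mul_inv_eq_one]
    constructor
    · exact fun h => ⟨h.2.2, h.1.symm, h.2.1.symm⟩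
    · exact fun h => ⟨h.2.1.symm, h.2.2.symm, h.1⟩

end Words

section PresentedGroups

variable {J D : Type} [Fintype D] {a b m m' : J → D → ℤ} {w : D → ℤ}

lemma PresentedGroup.lift_of_eq_one {X : Type*} {R : Set (FreeGroup X)} {r : FreeGroup X}
    (hr : r ∈ R) : FreeGroup.lift (fun x => (PresentedGroup.of x : PresentedGroup R)) r = 1 := by
  have e : FreeGroup.lift (fun x => (PresentedGroup.of x : PresentedGroup R)) =
      PresentedGroup.mk R := by ext; simp [PresentedGroup.of]
  rw [e]
  exact PresentedGroup.one_of_mem hr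

/-- There is a universal group with elements satisfying the relations. -/
lemma GenRel.exists_universal [Finite J] (a b m m' : J → D → ℤ) (w : D → ℤ) (e : D) (n : ℕ) :
    ∃ (Γ : Type) (_ : Group Γ) (g : Gen J D → Γ), GenRel a b m m' w g ∧
      g .e = g (.base (.x e)) ^ n ∧
      (∀ {H : Type} [Group H] (f : Gen J D → H), GenRel a b m m' w f →
        f .e = f (.base (.x e)) ^ n → ∃ φ : Γ →* H, ∀ z, φ (g z) = f z) ∧
      ∀ {H : Type} [Group H] (φ ψ : Γ →* H), (∀ z, φ (g z) = ψ (g z)) → φ = ψ := by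
  obtain ⟨R, -, hR⟩ := GenRel.exists_relators a b m m' w
  let R' : Set (FreeGroup (Gen J D)) :=
    insert (FreeGroup.of .e * (FreeGroup.of (.base (.x e)) ^ n)⁻¹) R
  have hR' : ∀ {H : Type} [Group H] (f : Gen J D → H), (∀ r ∈ R', FreeGroup.lift f r = 1) ↔
      GenRel a b m m' w f ∧ f .e = f (.base (.x e)) ^ n := by
    intro H _ f
    simp only [R', Set.forall_mem_insert, hR, map_mul, map_inv, map_pow, FreeGroup.lift_apply_of,
      mul_inv_eq_one]
    exact and_comm
  obtain ⟨h₁, h₂⟩ := (hR' (fun z => (PresentedGroup.of z : PresentedGroup R'))).1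
    fun r => PresentedGroup.lift_of_eq_one
  refine ⟨PresentedGroup R', inferInstance, PresentedGroup.of, h₁, h₂, ?_, ?_⟩
  · intro H _ f h h'
    exact ⟨PresentedGroup.toGroup ((hR' f).2 ⟨h, h'⟩), fun z => PresentedGroup.toGroup.of _⟩
  · intro H _ φ ψ h
    exact PresentedGroup.ext h

/-- The relations imposed on the double, for the parameter `n`. -/
def DoubleRelAt (a b m m' : J → D → ℤ) (w : D → ℤ) (e : D) (n : ℕ) {H : Type*} [Group H]
    (f : Bool → Gen J D → H) : Prop :=
  DoubleRel a b m m' w f ∧ ∀ i, f i .e = f i (.base (.x e)) ^ n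

/-- The group `Q` is universal among those with a family satisfying the relations of the double. -/
structure IsDouble (a b m m' : J → D → ℤ) (w : D → ℤ) (e : D) (n : ℕ) {Q : Type} [Group Q]
    (d : Bool → Gen J D → Q) : Prop where
  rel : DoubleRelAt a b m m' w e n d
  exists_lift : ∀ {H : Type} [Group H] (f : Bool → Gen J D → H), DoubleRelAt a b m m' w e n f →
    ∃ φ : Q →* H, ∀ i z, φ (d i z) = f i z
  ext : ∀ {H : Type} [Group H] {φ ψ : Q →* H}, (∀ i z, φ (d i z) = ψ (d i z)) → φ = ψ

lemma IsDouble.of_presentedGroup {e : D} {n : ℕ} {X : Type} {R : Set (FreeGroup X)}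
    (ν : Bool × Gen J D ≃ X)
    (hR : ∀ {H : Type} [Group H] (f : X → H), (∀ r ∈ R, FreeGroup.lift f r = 1) ↔
      DoubleRelAt a b m m' w e n fun i z => f (ν (i, z))) :
    IsDouble a b m m' w e n fun i z => (PresentedGroup.of (ν (i, z)) : PresentedGroup R) where
  rel := (hR fun x => (PresentedGroup.of x : PresentedGroup R)).1
    fun _ => PresentedGroup.lift_of_eq_one
  exists_lift f hf := by
    have h := (hR fun x => f (ν.symm x).1 (ν.symm x).2).2 (by simpa using hf)
    exact ⟨PresentedGroup.toGroup h, fun i z => by simp⟩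
  ext h := PresentedGroup.ext fun x => by simpa using h (ν.symm x).1 (ν.symm x).2

section Double

variable {e : D} {n : ℕ} {Q : Type} [Group Q] {d : Bool → Gen J D → Q}

lemma IsDouble.eq_one_of_map_u (h : IsDouble a b m m' w e n d) {H : Type} [Group H] (φ : Q →* H)
    (hu : ∀ i, φ (d i .u) = 1) : φ = 1 :=
  h.ext fun i z => ((h.rel.1.gen i).map φ).eq_one_of_u_eq_one
    (by rw [h.rel.2 i, map_pow]) (hu i) z

lemma IsDouble.noNontrivialFiniteQuotients (h : IsDouble a b m m' w e n d) :
    NoNontrivialFiniteQuotients Q := fun _ _ _ φ q => by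
  rw [h.eq_one_of_map_u φ fun i => ((h.rel.1.gen i).map φ).u_eq_one_of_finite, MonoidHom.one_apply]

lemma IsDouble.commutator_eq_top (h : IsDouble a b m m' w e n d) : commutator Q = ⊤ := by
  rw [← Abelianization.ker_of, MonoidHom.ker_eq_top_iff]
  exact h.eq_one_of_map_u _ fun i => ((h.rel.1.gen i).map Abelianization.of).u_eq_one_of_comm

lemma IsDouble.subsingleton_iff [DecidableEq D] (h : IsDouble a b m m' w e n d)
    (hm : ∀ j i, m j i = 0 ↔ m' j i = 0) :
    Subsingleton Q ↔ Relation.EqvGen (AffineStep a b m m') (Pi.single e (n : ℤ)) w := by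
  refine ⟨fun hQ => ?_, fun hn => ?_⟩
  · by_contra hn
    obtain ⟨M, _, f, hf, hfe, hfu⟩ := exists_genRel hm hn
    obtain ⟨φ, hφ⟩ := h.exists_lift (fun _ => f) ⟨⟨fun _ => hf, rfl⟩, fun _ => hfe⟩
    rw [← hφ false, Subsingleton.elim (d false .u) 1, map_one] at hfu
    exact hfu IsOfFinOrder.one
  · have := h.eq_one_of_map_u (MonoidHom.id Q) fun i =>
      (h.rel.1.gen i).u_eq_one_of_eqvGen (h.rel.2 i) hn
    exact ⟨fun x y => (DFunLike.congr_fun this x).trans (DFunLike.congr_fun this y).symm⟩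

lemma IsDouble.nontrivial_H2 [Finite J] [DecidableEq D] (h : IsDouble a b m m' w e n d)
    (hm : ∀ j i, m j i = 0 ↔ m' j i = 0) (hQ : Nontrivial Q) : Nontrivial (H2 Q) := by
  rw [← not_subsingleton_iff_nontrivial, h.subsingleton_iff hm] at hQ
  obtain ⟨M, _, f, hf, hfe, hfu⟩ := exists_genRel hm hQ
  obtain ⟨Γ, _, g, hg, hge, hlift, hext⟩ := GenRel.exists_universal a b m m' w e n
  have hΓ : commutator Γ = ⊤ := by
    rw [← Abelianization.ker_of, MonoidHom.ker_eq_top_iff]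
    exact hext _ _ fun z => (hg.map _).eq_one_of_u_eq_one (by rw [hge, map_pow])
      (hg.map Abelianization.of).u_eq_one_of_comm z
  choose j hj using fun i => hlift (d i) (h.rel.1.gen i) (h.rel.2 i)
  obtain ⟨φ, hφ⟩ := hlift f hf hfe
  refine H2.nontrivial_of_double h.commutator_eq_top hΓ (j false) (j true) (g .u) ?_ ?_ φ ?_
  · rw [hj, hj, h.rel.1.u_eq]
  · intro G _ α β hαβ
    obtain ⟨ψ, hψ⟩ := h.exists_lift (fun i z => if i then β (g z) else α (g z))
      ⟨⟨by rintro (_ | _); exacts [hg.map α, hg.map β], hαβ⟩,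
        by rintro (_ | _) <;> simp [hge]⟩
    exact ⟨ψ, hext _ _ fun z => by simp [hj, hψ], hext _ _ fun z => by simp [hj, hψ]⟩
  · rwa [hφ]

end Double

end PresentedGroups

/-- **Lemma 2.1 / Corollary 2.2.** There is a computable sequence of finite sets `Σ̄_n` of
words in `k` generators, of constant cardinality `c > k`, such that each group
`Λ_n = ⟨x₁,…,x_k ∣ Σ̄_n⟩` has no nontrivial finite quotients, `H₂(Λ_n;ℤ) ≠ 0` whenever
`Λ_n ≠ 1`, and no algorithm decides for which `n` the group `Λ_n` is trivial. -/
theorem exists_undecidable_triviality_sequence :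
    ∃ (k c : ℕ) (Sig : ℕ → List (List (Fin k × Bool))),
      Computable Sig ∧ c > k ∧ (∀ n, (Sig n).toFinset.card = c) ∧
      (∀ n, NoNontrivialFiniteQuotients (wordPresentedGroup k (Sig n))) ∧
      (∀ n, Nontrivial (wordPresentedGroup k (Sig n)) →
        Nontrivial (H2 (wordPresentedGroup k (Sig n)))) ∧
      ¬ ∃ f : ℕ → Bool, Computable f ∧
          ∀ n, f n = true ↔ Subsingleton (wordPresentedGroup k (Sig n)) := by
  obtain ⟨J, D, _, _, _, a, b, m, m', e, w, hm, hund⟩ :=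
    StackMachine.exists_undecidable_affineStep
  have := Fintype.ofFinite D
  obtain ⟨k, ⟨ν⟩⟩ := Finite.exists_equiv_fin (Bool × Gen J D)
  obtain ⟨R, hRfin, hR⟩ := DoubleRel.exists_relators (fun i z => ν (i, z)) a b m m' w
  obtain ⟨c, Sig, hcomp, hc, hcard, hSig⟩ := exists_computable_words hRfin
    (x := ν (false, .base (.x e))) (e := ν (false, .e)) (x' := ν (true, .base (.x e)))
    (e' := ν (true, .e)) (by simp) (by simp) (by simp)
  have key : ∀ n, IsDouble a b m m' w e n
      fun i z => (PresentedGroup.of (ν (i, z)) : wordPresentedGroup k (Sig n)) := by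
    refine fun n => .of_presentedGroup ν fun f => ?_
    rw [hSig, hR, DoubleRelAt, Bool.forall_bool]
  refine ⟨k, c, Sig, hcomp, hc, hcard, fun n => (key n).noNontrivialFiniteQuotients,
    fun n => (key n).nontrivial_H2 hm, ?_⟩
  rintro ⟨f, hf, hf'⟩
  exact hund ⟨f, hf, fun n => (hf' n).trans ((key n).subsingleton_iff hm)⟩
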